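/- The plane Cremona group is perfect: [Bir(ℙ²_ℂ), Bir(ℙ²_ℂ)] = Bir(ℙ²_ℂ); that is, the commutator subgroup of the group Aut_ℂ(ℂ(x,y)) equals the whole group Aut_ℂ(ℂ(x,y)). -/

import Mathlib

set_option autoImplicit false

noncomputable section

/-- The field `ℂ(x,y)` of rational functions in two variables over `ℂ`. -/
abbrev K2 : Type := FractionRing (MvPolynomial (Fin 2) ℂ)

/-- The plane Cremona group `Bir(ℙ²_ℂ)`, identified with the group `Aut_ℂ(ℂ(x,y))`
of `ℂ`-algebra automorphisms of `ℂ(x,y)`. -/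
abbrev Cremona2 : Type := K2 ≃ₐ[ℂ] K2

/-- The coordinate function `x`. -/
def X0 : K2 := algebraMap (MvPolynomial (Fin 2) ℂ) K2 (MvPolynomial.X 0)

/-- The coordinate function `y`. -/
def X1 : K2 := algebraMap (MvPolynomial (Fin 2) ℂ) K2 (MvPolynomial.X 1)

namespace Cremona

open MvPolynomial WithZero

/-- The polynomial ring `ℂ[x,y]`. -/
abbrev R2 : Type := MvPolynomial (Fin 2) ℂ

/-! ### Derivations of `ℂ(x,y)` and Jacobian determinants -/

/-- The `ℂ`-algebra map `ℂ(x,y) → ℂ(x,y)[ε]` underlying the `i`-th partial derivative. -/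
def dualLift (i : Fin 2) : K2 →ₐ[ℂ] TrivSqZeroExt K2 K2 :=
  IsLocalization.liftAlgHom (M := nonZeroDivisors R2)
    (f := aeval fun j => TrivSqZeroExt.inl (algebraMap R2 K2 (X j)) +
      TrivSqZeroExt.inr (if i = j then 1 else 0)) (by
    intro s
    rw [TrivSqZeroExt.isUnit_iff_isUnit_fst, isUnit_iff_ne_zero]
    have h : (TrivSqZeroExt.fstHom ℂ K2 K2).comp
        (aeval fun j => TrivSqZeroExt.inl (algebraMap R2 K2 (X j)) +
          TrivSqZeroExt.inr (if i = j then 1 else 0)) = Algebra.algHom ℂ R2 K2 := by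
      ext j; by_cases h : i = j <;> simp [h, Algebra.algHom]
    have h' := DFunLike.congr_fun h s.1
    change TrivSqZeroExt.fst _ = _ at h'
    erw [h']
    exact IsFractionRing.to_map_ne_zero_of_mem_nonZeroDivisors s.2)

theorem dualLift_algebraMap (i : Fin 2) (r : R2) :
    dualLift i (algebraMap R2 K2 r) = aeval (fun j => TrivSqZeroExt.inl (algebraMap R2 K2 (X j)) +
      TrivSqZeroExt.inr (if i = j then 1 else 0)) r := by
  simp [dualLift, IsLocalization.liftAlgHom_apply]

theorem algHom_ext_K2 {A : Type*} [Semiring A] [Algebra ℂ A] {f g : K2 →ₐ[ℂ] A}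
    (h0 : f X0 = g X0) (h1 : f X1 = g X1) : f = g := by
  have h : (f.comp (Algebra.algHom ℂ R2 K2)) = (g.comp (Algebra.algHom ℂ R2 K2)) := by
    ext i; fin_cases i
    · exact h0
    · exact h1
  refine IsLocalization.algHom_ext (nonZeroDivisors R2) ?_
  exact h

theorem fst_dualLift (i : Fin 2) (f : K2) : (dualLift i f).fst = f := by
  have h : (TrivSqZeroExt.fstHom ℂ K2 K2).comp (dualLift i) = AlgHom.id ℂ K2 := by
    apply algHom_ext_K2 <;> fin_cases i <;> simp [X0, X1, dualLift_algebraMap]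
  exact DFunLike.congr_fun h f

/-- The partial derivatives of rational functions. -/
def pd (i : Fin 2) : Derivation ℂ K2 K2 :=
  Derivation.mk' ((TrivSqZeroExt.sndHom K2 K2).restrictScalars ℂ ∘ₗ (dualLift i).toLinearMap) (by
    intro a b
    simp [fst_dualLift, mul_comm])

theorem pd_apply (i : Fin 2) (f : K2) : pd i f = (dualLift i f).snd := rfl

theorem pd_X (i j : Fin 2) : pd i (algebraMap R2 K2 (X j)) = if i = j then 1 else 0 := by
  by_cases h : i = j <;> simp [pd_apply, dualLift_algebraMap, h]

@[simp] theorem pd_zero_X0 : pd 0 X0 = 1 := by simp [X0, pd_X]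
@[simp] theorem pd_zero_X1 : pd 0 X1 = 0 := by simp [X1, pd_X]
@[simp] theorem pd_one_X0 : pd 1 X0 = 0 := by simp [X0, pd_X]
@[simp] theorem pd_one_X1 : pd 1 X1 = 1 := by simp [X1, pd_X]

theorem exists_frac (f : K2) : ∃ a b : R2, b ≠ 0 ∧ f = algebraMap R2 K2 a / algebraMap R2 K2 b := by
  obtain ⟨a, b, hb, rfl⟩ := IsFractionRing.div_surjective (A := R2) f
  exact ⟨a, b, nonZeroDivisors.ne_zero hb, rfl⟩

theorem derivation_ext_K2 {D E : Derivation ℂ K2 K2} (h0 : D X0 = E X0) (h1 : D X1 = E X1) :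
    D = E := by
  have h : D.compAlgebraMap R2 = E.compAlgebraMap R2 := by
    apply derivation_ext
    intro i; fin_cases i
    · exact h0
    · exact h1
  have h' : ∀ r : R2, D (algebraMap R2 K2 r) = E (algebraMap R2 K2 r) :=
    fun r => DFunLike.congr_fun h r
  ext f
  obtain ⟨a, b, -, rfl⟩ := exists_frac f
  rw [Derivation.leibniz_div, Derivation.leibniz_div, h', h']

theorem pd_algebraMap (i : Fin 2) (r : R2) :
    pd i (algebraMap R2 K2 r) = algebraMap R2 K2 (pderiv i r) := by
  have h : (pd i).compAlgebraMap R2 =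
      (Algebra.linearMap R2 K2).compDer (pderiv i) := by
    apply derivation_ext
    intro j
    change pd i (algebraMap R2 K2 (X j)) = algebraMap R2 K2 (pderiv i (X j))
    rw [pd_X, pderiv_X, Pi.single_apply, apply_ite (algebraMap R2 K2)]
    simp [eq_comm]
  exact DFunLike.congr_fun h r

/-- The Jacobian determinant of a pair of rational functions. -/
def Jac (f g : K2) : K2 := pd 0 f * pd 1 g - pd 1 f * pd 0 g

theorem Jac_X0_X1 : Jac X0 X1 = 1 := by simp [Jac]

theorem derivation_eq (D : Derivation ℂ K2 K2) (f : K2) :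
    D f = D X0 * pd 0 f + D X1 * pd 1 f := by
  have : D = D X0 • pd 0 + D X1 • pd 1 := by
    apply derivation_ext_K2 <;> simp
  conv_lhs => rw [this]
  simp

/-- The conjugate of a derivation by an automorphism. -/
def conjDer (τ : Cremona2) (D : Derivation ℂ K2 K2) : Derivation ℂ K2 K2 :=
  Derivation.mk' (τ.symm.toLinearMap ∘ₗ D.toLinearMap ∘ₗ τ.toLinearMap) (by
    intro a b
    simp [Derivation.leibniz])

theorem conjDer_apply (τ : Cremona2) (D : Derivation ℂ K2 K2) (f : K2) :
    conjDer τ D f = τ.symm (D (τ f)) := rfl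

theorem pd_auto (τ : Cremona2) (i : Fin 2) (f : K2) :
    pd i (τ f) = pd i (τ X0) * τ (pd 0 f) + pd i (τ X1) * τ (pd 1 f) := by
  have h := derivation_eq (conjDer τ (pd i)) f
  have h2 := congrArg τ h
  simpa [conjDer_apply] using h2

theorem Jac_auto (τ : Cremona2) (f g : K2) :
    Jac (τ f) (τ g) = τ (Jac f g) * Jac (τ X0) (τ X1) := by
  simp only [Jac, pd_auto τ _ f, pd_auto τ _ g, map_sub, map_mul]
  ring

theorem Jac_auto_ne_zero (τ : Cremona2) : Jac (τ X0) (τ X1) ≠ 0 := by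
  intro h
  have := Jac_auto τ (τ.symm X0) (τ.symm X1)
  simp [h, Jac_X0_X1] at this

theorem Jac_swap (f g : K2) : Jac g f = -Jac f g := by
  simp [Jac]; ring

theorem Jac_sub_const (f g : K2) (s t : ℂ) :
    Jac (f - algebraMap ℂ K2 s) (g - algebraMap ℂ K2 t) = Jac f g := by
  simp [Jac]

theorem Jac_div (f g : K2) (hf : f ≠ 0) : Jac f (g / f) = Jac f g / f := by
  simp only [Jac, Derivation.leibniz_div, smul_eq_mul]
  field_simp
  ring

theorem Jac_inv_right (f g : K2) (hg : g ≠ 0) : Jac f g⁻¹ = -(g ^ 2)⁻¹ * Jac f g := by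
  simp only [Jac, Derivation.leibniz_inv, smul_eq_mul]
  field_simp
  ring

theorem derivation_zpow (D : Derivation ℂ K2 K2) (f : K2) (hf : f ≠ 0) (n : ℤ) :
    D (f ^ n) = n * f ^ (n - 1) * D f := by
  cases n with
  | ofNat n =>
    rcases n with _ | n
    · simp
    · rw [Int.ofNat_eq_natCast, zpow_natCast, Derivation.leibniz_pow]
      have : f ^ (((n + 1 : ℕ) : ℤ) - 1) = f ^ n := by
        rw [← zpow_natCast]; congr 1; push_cast; ring
      rw [this]
      simp [mul_assoc]
  | negSucc n =>
    rw [zpow_negSucc, Derivation.leibniz_inv, Derivation.leibniz_pow]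
    have : f ^ (Int.negSucc n - 1) = (f ^ (n + 2))⁻¹ := by
      rw [← zpow_natCast, ← zpow_neg]; congr 1
    rw [this]
    simp
    field_simp
    ring

theorem Jac_inv_mul_zpow (f g : K2) (hf : f ≠ 0) (n : ℤ) :
    Jac f⁻¹ (g * f ^ (-n)) = -f ^ (-2 - n) * Jac f g := by
  simp only [Jac, Derivation.leibniz_inv, Derivation.leibniz, derivation_zpow _ f hf, smul_eq_mul]
  rw [sub_eq_add_neg (-2 : ℤ) n, zpow_add₀ hf]
  have : f ^ (-2 : ℤ) = f⁻¹ ^ 2 := by rw [zpow_neg]; norm_cast; simp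
  rw [this]
  ring

theorem Jac_eq_zero_of_Jac_eq_zero {x y : K2} (h0 : Jac X0 x = 0) (h1 : Jac X1 x = 0) :
    Jac x y = 0 := by
  simp only [Jac, pd_zero_X0, pd_zero_X1, pd_one_X0, pd_one_X1] at h0 h1 ⊢
  have h2 : pd 1 x = 0 := by linear_combination h0
  have h3 : pd 0 x = 0 := by linear_combination -h1
  simp [h2, h3]

/-! ### Divisorial valuations -/

/-- The valuation on `ℂ[x,y]` given by the multiplicity of a prime element. -/
def primeValR (p : R2) (hp : Prime p) : Valuation R2 ℤᵐ⁰ where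
  toFun f := if f = 0 then 0 else exp (-(multiplicity p f : ℤ))
  map_zero' := by simp
  map_one' := by
    simp [multiplicity_eq_zero.2 (fun h => hp.not_isUnit (isUnit_of_dvd_one h))]
  map_mul' f g := by
    by_cases hf : f = 0
    · simp [hf]
    by_cases hg : g = 0
    · simp [hg]
    have hfg : f * g ≠ 0 := mul_ne_zero hf hg
    rw [if_neg hf, if_neg hg, if_neg hfg, ← exp_add,
      multiplicity_mul hp (FiniteMultiplicity.of_not_isUnit hp.not_isUnit hfg)]
    congr 1; push_cast; ring
  map_add_le_max' f g := by
    by_cases hf : f = 0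
    · simp [hf]
    by_cases hg : g = 0
    · simp [hg]
    by_cases hfg : f + g = 0
    · simp [hfg]
    rw [if_neg hf, if_neg hg, if_neg hfg, le_max_iff, exp_le_exp, exp_le_exp]
    have h := pow_dvd_of_le_multiplicity (min_le_left (multiplicity p f) (multiplicity p g))
    have h' := pow_dvd_of_le_multiplicity (min_le_right (multiplicity p f) (multiplicity p g))
    have := (FiniteMultiplicity.of_not_isUnit hp.not_isUnit hfg).le_multiplicity_of_pow_dvd
      (dvd_add h h')
    rcases min_choice (multiplicity p f) (multiplicity p g) with h | h <;> rw [h] at this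
    · left; omega
    · right; omega

theorem primeValR_apply {p : R2} (hp : Prime p) {f : R2} (hf : f ≠ 0) :
    primeValR p hp f = exp (-(multiplicity p f : ℤ)) := if_neg hf

theorem primeValR_le_one {p : R2} (hp : Prime p) (f : R2) : primeValR p hp f ≤ 1 := by
  by_cases hf : f = 0
  · simp [hf]
  · rw [primeValR_apply hp hf, ← exp_zero, exp_le_exp]; omega

theorem primeValR_lt_one_iff {p : R2} (hp : Prime p) (f : R2) :
    primeValR p hp f < 1 ↔ p ∣ f := by
  by_cases hf : f = 0
  · simp [hf]
  · rw [primeValR_apply hp hf, ← exp_zero, exp_lt_exp]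
    have := multiplicity_eq_zero (a := p) (b := f)
    rw [← not_iff_not, ← this]; omega

theorem primeValR_supp {p : R2} (hp : Prime p) :
    nonZeroDivisors R2 ≤ (primeValR p hp).supp.primeCompl := by
  intro s hs
  have hs0 : s ≠ 0 := nonZeroDivisors.ne_zero hs
  change s ∉ (primeValR p hp).supp
  rw [Valuation.mem_supp_iff, primeValR_apply hp hs0]
  exact exp_ne_zero

/-- The valuation on `ℂ(x,y)` given by the multiplicity of a prime element of `ℂ[x,y]`. -/
def primeVal (p : R2) (hp : Prime p) : Valuation K2 ℤᵐ⁰ :=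
  (primeValR p hp).extendToLocalization (primeValR_supp hp) K2

theorem primeVal_algebraMap {p : R2} (hp : Prime p) (f : R2) :
    primeVal p hp (algebraMap R2 K2 f) = primeValR p hp f :=
  Valuation.extendToLocalization_apply_map_apply _ _ _ _

theorem primeVal_algebraMap_le_one {p : R2} (hp : Prime p) (f : R2) :
    primeVal p hp (algebraMap R2 K2 f) ≤ 1 :=
  (primeVal_algebraMap hp f).trans_le (primeValR_le_one hp f)

theorem primeVal_algebraMap_lt_one_iff {p : R2} (hp : Prime p) (f : R2) :
    primeVal p hp (algebraMap R2 K2 f) < 1 ↔ p ∣ f := by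
  rw [primeVal_algebraMap, primeValR_lt_one_iff]

theorem primeVal_algebraMap_eq_one {p : R2} (hp : Prime p) {f : R2} (h : ¬ p ∣ f) :
    primeVal p hp (algebraMap R2 K2 f) = 1 :=
  le_antisymm (primeVal_algebraMap_le_one hp f)
    (not_lt.1 (mt (primeVal_algebraMap_lt_one_iff hp f).1 h))

theorem primeVal_self {p : R2} (hp : Prime p) :
    primeVal p hp (algebraMap R2 K2 p) = exp (-1) := by
  rw [primeVal_algebraMap, primeValR_apply hp hp.ne_zero, multiplicity_self]; rfl

theorem primeVal_const {p : R2} (hp : Prime p) (c : ℂ) :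
    primeVal p hp (algebraMap ℂ K2 c) ≤ 1 := by
  rw [IsScalarTower.algebraMap_apply ℂ R2 K2]
  exact primeVal_algebraMap_le_one hp _

theorem exists_relPrime_frac (f : K2) : ∃ a b : R2, b ≠ 0 ∧ IsRelPrime a b ∧
    f = algebraMap R2 K2 a / algebraMap R2 K2 b := by
  refine ⟨IsFractionRing.num R2 f, IsFractionRing.den R2 f,
    nonZeroDivisors.ne_zero (IsFractionRing.den R2 f).2, IsFractionRing.num_den_reduced R2 f, ?_⟩
  rw [← IsFractionRing.mk'_eq_div, IsFractionRing.mk'_num_den]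

theorem exists_frac_of_primeVal_le_one {p : R2} (hp : Prime p) {f : K2}
    (hf : primeVal p hp f ≤ 1) : ∃ a b : R2, ¬ p ∣ b ∧
    f = algebraMap R2 K2 a / algebraMap R2 K2 b := by
  obtain ⟨a, b, hb, hab, rfl⟩ := exists_relPrime_frac f
  refine ⟨a, b, fun hpb => ?_, rfl⟩
  have ha := primeVal_algebraMap_eq_one hp fun hpa => hp.not_isUnit (hab hpa hpb)
  rw [map_div₀, ha, one_div, inv_le_one₀ ?_] at hf
  · exact absurd ((primeVal_algebraMap_lt_one_iff hp b).2 hpb) (not_lt.2 hf)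
  · rw [zero_lt_iff, Valuation.ne_zero_iff]
    simpa using hb

theorem mem_range_of_primeVal_le_one {f : K2}
    (hf : ∀ (p : R2) (hp : Prime p), primeVal p hp f ≤ 1) :
    ∃ r : R2, algebraMap R2 K2 r = f := by
  obtain ⟨a, b, hb, hab, rfl⟩ := exists_relPrime_frac f
  by_cases hu : IsUnit b
  · obtain ⟨u, rfl⟩ := hu
    refine ⟨a * ↑u⁻¹, ?_⟩
    rw [map_mul, div_eq_mul_inv]
    congr 1
    refine eq_inv_of_mul_eq_one_left ?_
    rw [← map_mul]
    simp
  · obtain ⟨p, hp, hpb⟩ := WfDvdMonoid.exists_irreducible_factor hu hb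
    have hp' := hp.prime
    have ha := primeVal_algebraMap_eq_one hp' fun hpa => hp'.not_isUnit (hab hpa hpb)
    have hf' := hf p hp'
    rw [map_div₀, ha, one_div, inv_le_one₀ ?_] at hf'
    · exact absurd ((primeVal_algebraMap_lt_one_iff hp' b).2 hpb) (not_lt.2 hf')
    · rw [zero_lt_iff, Valuation.ne_zero_iff]
      simpa using hb

theorem primeVal_pd_le_one {p : R2} (hp : Prime p) (i : Fin 2) {f : K2}
    (hf : primeVal p hp f ≤ 1) : primeVal p hp (pd i f) ≤ 1 := by
  obtain ⟨a, b, hb, rfl⟩ := exists_frac_of_primeVal_le_one hp hf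
  have hb1 := primeVal_algebraMap_eq_one hp hb
  rw [Derivation.leibniz_div, pd_algebraMap, pd_algebraMap, smul_eq_mul, smul_eq_mul, smul_eq_mul,
    map_mul, map_pow, map_inv₀, hb1, ← map_mul, ← map_mul, ← map_sub]
  simp only [inv_one, one_pow, one_mul]
  exact primeVal_algebraMap_le_one hp _

theorem primeVal_Jac_le_one {p : R2} (hp : Prime p) {f g : K2}
    (hf : primeVal p hp f ≤ 1) (hg : primeVal p hp g ≤ 1) : primeVal p hp (Jac f g) ≤ 1 := by
  have hfd := fun i => primeVal_pd_le_one hp i hf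
  have hgd := fun i => primeVal_pd_le_one hp i hg
  refine (Valuation.map_sub _ _ _).trans (max_le ?_ ?_) <;> rw [map_mul]
  · exact mul_le_one' (hfd 0) (hgd 1)
  · exact mul_le_one' (hfd 1) (hgd 0)

/-- A discrete valuation `v` of `ℂ(x,y)`, trivial on `ℂ`, with a generator `θ⁻¹ dx ∧ dy` of the
`2`-forms regular along `v`. -/
structure DivVal where
  /-- the valuation -/
  v : Valuation K2 ℤᵐ⁰
  /-- the normalizing factor for Jacobian determinants -/
  θ : K2
  θ_ne_zero : θ ≠ 0
  const_le_one : ∀ c : ℂ, v (algebraMap ℂ K2 c) ≤ 1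
  jac_le_one : ∀ f g : K2, v f ≤ 1 → v g ≤ 1 → v (θ * Jac f g) ≤ 1

theorem DivVal.const_eq_one (w : DivVal) {c : ℂ} (hc : c ≠ 0) : w.v (algebraMap ℂ K2 c) = 1 := by
  refine le_antisymm (w.const_le_one c) ?_
  have h := w.const_le_one c⁻¹
  rwa [map_inv₀, map_inv₀, inv_le_one₀] at h
  rw [zero_lt_iff, Valuation.ne_zero_iff]
  simpa using hc

/-- The valuation of a prime element, as a `DivVal`. -/
def affineVal (p : R2) (hp : Prime p) : DivVal where
  v := primeVal p hp
  θ := 1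
  θ_ne_zero := one_ne_zero
  const_le_one := primeVal_const hp
  jac_le_one f g hf hg := by rw [one_mul]; exact primeVal_Jac_le_one hp hf hg

/-- The valuation of a prime element in the coordinates given by an automorphism. -/
def twistedVal (p : R2) (hp : Prime p) (τ : Cremona2) : DivVal where
  v := (primeVal p hp).comap (τ : K2 →+* K2)
  θ := τ.symm (Jac (τ X0) (τ X1))
  θ_ne_zero := by simpa using Jac_auto_ne_zero τ
  const_le_one c := by
    rw [Valuation.comap_apply]
    simpa using primeVal_const hp c
  jac_le_one f g hf hg := by
    rw [Valuation.comap_apply] at hf hg ⊢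
    have h := primeVal_Jac_le_one hp hf hg
    have e : (τ : K2 →+* K2) (τ.symm (Jac (τ X0) (τ X1)) * Jac f g) = Jac (τ f) (τ g) := by
      change τ (τ.symm _ * _) = _
      rw [map_mul, τ.apply_symm_apply, Jac_auto τ f g, mul_comm]
    rw [e]
    exact h

/-! ### Endomorphisms and automorphisms of `ℂ(x,y)` -/

theorem derivation_aeval (D : Derivation ℂ K2 K2) (a b : K2) (P : R2) :
    D (aeval ![a, b] P) = aeval ![a, b] (pderiv 0 P) * D a + aeval ![a, b] (pderiv 1 P) * D b := by
  induction P using MvPolynomial.induction_on with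
  | C c => simp
  | add p q hp hq => simp only [map_add, hp, hq]; ring
  | mul_X p i hp =>
    have e : ∀ j, pderiv j (p * X i) = pderiv j p * X i + p * (if i = j then 1 else 0) := by
      intro j
      rw [Derivation.leibniz, pderiv_X, Pi.single_apply]
      simp only [smul_eq_mul]
      by_cases h : j = i
      · subst h; simp; ring
      · simp [Ne.symm h, mul_comm]
    rw [map_mul, Derivation.leibniz, hp, e, e]
    fin_cases i <;> simp <;> ring

theorem eq_C_of_pderiv_eq_zero {P : R2} (h0 : pderiv 0 P = 0) (h1 : pderiv 1 P = 0) :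
    P = C (coeff 0 P) := by
  have key : ∀ (i : Fin 2), pderiv i P = 0 → ∀ m : Fin 2 →₀ ℕ, m i ≠ 0 → coeff m P = 0 := by
    intro i hi m hm
    have := coeff_pderiv (i := i) P (m - Finsupp.single i 1)
    rw [hi, coeff_zero, Finsupp.sub_add_single_one_cancel hm] at this
    rcases mul_eq_zero.1 this.symm with h | h
    · exact h
    · norm_cast at h
  ext m
  rw [coeff_C]
  split_ifs with h
  · rw [h]
  · obtain ⟨i, hi⟩ := DFunLike.ne_iff.1 h
    fin_cases i
    · exact key 0 h0 m (by simpa [eq_comm] using hi)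
    · exact key 1 h1 m (by simpa [eq_comm] using hi)

theorem totalDegree_pderiv_lt {P : R2} {i : Fin 2} {n : ℕ} (hP : P.totalDegree ≤ n + 1) :
    (pderiv i P).totalDegree ≤ n := by
  refine Finset.sup_le fun m hm => ?_
  rw [mem_support_iff, coeff_pderiv] at hm
  have h := le_totalDegree (mem_support_iff.2 (left_ne_zero_of_mul hm))
  rw [Finsupp.sum_add_index' (fun _ => rfl) (fun _ _ _ => rfl), Finsupp.sum_single_index rfl] at h
  exact Nat.le_of_succ_le_succ (h.trans hP)

theorem aeval_injective_of_Jac_ne_zero {a b : K2} (h : Jac a b ≠ 0) {P : R2}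
    (hP : aeval ![a, b] P = 0) : P = 0 := by
  have key : ∀ (n : ℕ) (P : R2), P.totalDegree ≤ n → aeval ![a, b] P = 0 → P = 0 := by
    intro n
    induction n with
    | zero =>
      intro P hd hP
      rw [Nat.le_zero, totalDegree_eq_zero_iff_eq_C] at hd
      rw [hd] at hP ⊢
      simpa using hP
    | succ n ih =>
      intro P hd hP
      have e0 := derivation_aeval (pd 0) a b P
      have e1 := derivation_aeval (pd 1) a b P
      rw [hP, map_zero] at e0 e1
      have f0 : aeval ![a, b] (pderiv 0 P) = 0 := by
        refine (mul_eq_zero.1 (?_ : _ * Jac a b = 0)).resolve_right h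
        rw [Jac]; linear_combination - e0 * pd 1 b + e1 * pd 0 b
      have f1 : aeval ![a, b] (pderiv 1 P) = 0 := by
        refine (mul_eq_zero.1 (?_ : _ * Jac a b = 0)).resolve_right h
        rw [Jac]; linear_combination e0 * pd 1 a - e1 * pd 0 a
      have g := eq_C_of_pderiv_eq_zero (ih _ (totalDegree_pderiv_lt hd) f0)
        (ih _ (totalDegree_pderiv_lt hd) f1)
      rw [g] at hP ⊢
      simpa using hP
  exact key _ P le_rfl hP

/-- The endomorphism of `ℂ(x,y)` sending the coordinates to a pair with nonzero Jacobian. -/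
def endo (a b : K2) (h : Jac a b ≠ 0) : K2 →ₐ[ℂ] K2 :=
  IsLocalization.liftAlgHom (M := nonZeroDivisors R2) (f := aeval ![a, b]) (by
    intro s
    rw [isUnit_iff_ne_zero]
    intro hs
    exact nonZeroDivisors.ne_zero s.2 (aeval_injective_of_Jac_ne_zero h hs))

@[simp] theorem endo_X0 (a b : K2) (h : Jac a b ≠ 0) : endo a b h X0 = a := by
  simp [endo, X0, IsLocalization.liftAlgHom_apply]

@[simp] theorem endo_X1 (a b : K2) (h : Jac a b ≠ 0) : endo a b h X1 = b := by
  simp [endo, X1, IsLocalization.liftAlgHom_apply]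

theorem exists_auto {a b : K2} (a' b' : K2) (h : Jac a b ≠ 0) (h' : Jac a' b' ≠ 0)
    (e0 : endo a b h a' = X0) (e1 : endo a b h b' = X1)
    (e0' : endo a' b' h' a = X0) (e1' : endo a' b' h' b = X1) :
    ∃ g : Cremona2, g X0 = a ∧ g X1 = b :=
  ⟨AlgEquiv.ofAlgHom (endo a b h) (endo a' b' h')
    (algHom_ext_K2 (by simpa using e0) (by simpa using e1))
    (algHom_ext_K2 (by simpa using e0') (by simpa using e1')), by simp, by simp⟩

theorem cremona_ext {g h : Cremona2} (h0 : g X0 = h X0) (h1 : g X1 = h X1) : g = h := by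
  have := algHom_ext_K2 (f := g.toAlgHom) (g := h.toAlgHom) h0 h1
  exact AlgEquiv.ext fun z => DFunLike.congr_fun this z

/-! ### Elementary Cremona transformations -/

theorem X0_ne_zero : X0 ≠ 0 := by simp [X0]
theorem X1_ne_zero : X1 ≠ 0 := by simp [X1]

theorem X0_ne_const (c : ℂ) : X0 ≠ algebraMap ℂ K2 c := by
  intro h
  have := congrArg (pd 0) h
  simp at this

theorem X1_ne_const (c : ℂ) : X1 ≠ algebraMap ℂ K2 c := by
  intro h
  have := congrArg (pd 1) h
  simp at this

theorem X0_add_one_ne_zero : X0 + 1 ≠ 0 := by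
  intro h
  exact X0_ne_const (-1) (by simpa using eq_neg_of_add_eq_zero_left h)

theorem X0_sub_one_ne_zero : X0 - 1 ≠ 0 := by
  intro h
  exact X0_ne_const 1 (by simpa using sub_eq_zero.1 h)

theorem X1_sub_one_ne_zero : X1 - 1 ≠ 0 := by
  intro h
  exact X1_ne_const 1 (by simpa using sub_eq_zero.1 h)

theorem exists_translation (s : ℂ) :
    ∃ g : Cremona2, g X0 = X0 + algebraMap ℂ K2 s ∧ g X1 = X1 := by
  apply exists_auto (X0 - algebraMap ℂ K2 s) X1 <;> simp [Jac]

theorem exists_scaling {c d : ℂ} (hc : c ≠ 0) (hd : d ≠ 0) :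
    ∃ g : Cremona2, g X0 = algebraMap ℂ K2 c * X0 ∧ g X1 = algebraMap ℂ K2 d * X1 := by
  apply exists_auto (algebraMap ℂ K2 c⁻¹ * X0) (algebraMap ℂ K2 d⁻¹ * X1) <;>
    simp [Jac, Derivation.leibniz_inv, hc, hd]

theorem exists_swap : ∃ g : Cremona2, g X0 = X1 ∧ g X1 = X0 := by
  apply exists_auto X1 X0 <;> simp [Jac]

theorem exists_mul : ∃ g : Cremona2, g X0 = X0 ∧ g X1 = X0 * X1 := by
  apply exists_auto X0 (X1 / X0) <;> simp [Jac, Derivation.leibniz_div, X0_ne_zero,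
    mul_div_cancel₀]

theorem exists_inv : ∃ g : Cremona2, g X0 = X0 ∧ g X1 = X1⁻¹ := by
  apply exists_auto X0 X1⁻¹ <;> simp [Jac, Derivation.leibniz_inv, X1_ne_zero]

theorem exists_diagonalize : ∃ g : Cremona2, g X0 = X0 + X1 ∧ g X1 = X0 - X1 := by
  have h2 : pd 0 (2 : K2) = 0 ∧ pd 1 (2 : K2) = 0 :=
    ⟨mod_cast (pd 0).map_natCast 2, mod_cast (pd 1).map_natCast 2⟩
  have h : Jac (X0 + X1) (X0 - X1) ≠ 0 := by simp [Jac]; norm_num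
  have h' : Jac ((X0 + X1) / 2) ((X0 - X1) / 2) ≠ 0 := by
    simp [Jac, Derivation.leibniz_div, h2]; norm_num
  refine exists_auto ((X0 + X1) / 2) ((X0 - X1) / 2) h h' ?_ ?_ ?_ ?_ <;>
    simp only [map_add, map_sub, map_div₀, endo_X0, endo_X1, map_ofNat] <;> ring

theorem exists_moebius0 : ∃ g : Cremona2, g X0 = 1 + X0⁻¹ ∧ g X1 = X1 := by
  apply exists_auto (X0 - 1)⁻¹ X1 
  all_goals simp [Jac, Derivation.leibniz_inv, X0_ne_zero, X0_sub_one_ne_zero]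

theorem exists_moebius1 : ∃ g : Cremona2, g X0 = X0 ∧ g X1 = (X1 + 1) / (X1 - 1) := by
  have h : Jac X0 ((X1 + 1) / (X1 - 1)) ≠ 0 := by
    have e : X1 - 1 - (X1 + 1) ≠ 0 := by ring_nf; norm_num
    simpa [Jac, Derivation.leibniz_div, X1_sub_one_ne_zero] using e
  have e : endo X0 ((X1 + 1) / (X1 - 1)) h ((X1 + 1) / (X1 - 1)) = X1 := by
    have := X1_sub_one_ne_zero
    rw [map_div₀, map_add, map_sub, endo_X1, map_one,
      show (X1 + 1) / (X1 - 1) + 1 = 2 * X1 / (X1 - 1) by field_simp; ring,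
      show (X1 + 1) / (X1 - 1) - 1 = 2 / (X1 - 1) by field_simp; ring]
    field_simp
  apply exists_auto X0 ((X1 + 1) / (X1 - 1)) h h (by simp) e (by simp) e

theorem exists_moebius_mul : ∃ g : Cremona2, g X0 = X0 ∧ g X1 = (1 + X0⁻¹) * X1 := by
  have h : (1 + X0⁻¹) ≠ 0 := by
    have := X0_add_one_ne_zero
    have := X0_ne_zero
    rw [ne_eq, ← div_self X0_ne_zero, ← one_div, ← add_div]
    simp [*]
  apply exists_auto X0 (X1 / (1 + X0⁻¹)) <;>
    simp [Jac, Derivation.leibniz_div, Derivation.leibniz_inv, h, mul_div_cancel₀]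

/-! ### Elementary transformations are products of commutators -/

theorem mem_commutator_iff (g : Cremona2) :
    g ∈ commutator Cremona2 ↔ Abelianization.of g = 1 := by
  rw [← MonoidHom.mem_ker, Abelianization.ker_of]

theorem mem_commutator_of_conj {a b u : Cremona2} (h : u * a = b * u)
    (hb : b ∈ commutator Cremona2) : a ∈ commutator Cremona2 := by
  rw [mem_commutator_iff] at *
  have := congrArg Abelianization.of h
  rwa [map_mul, map_mul, hb, one_mul, mul_eq_left] at this

theorem mem_commutator_of_mul_eq_mul {a b c : Cremona2} (h : a * b = c * b * a) :
    c ∈ commutator Cremona2 := by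
  rw [mem_commutator_iff]
  have := congrArg Abelianization.of h
  rw [map_mul, map_mul, map_mul, mul_comm, mul_assoc] at this
  exact right_eq_mul.1 this

theorem translation_mem {g : Cremona2} {s : ℂ} (h0 : g X0 = X0 + algebraMap ℂ K2 s)
    (h1 : g X1 = X1) : g ∈ commutator Cremona2 := by
  obtain ⟨u, u0, u1⟩ := exists_scaling (two_ne_zero : (2 : ℂ) ≠ 0) (one_ne_zero : (1 : ℂ) ≠ 0)
  have h : g * u = u * g * g := by
    apply cremona_ext
    · simp [h0, u0]
      rw [map_ofNat]
      ring
    · simp [h1, u1]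
  rw [mem_commutator_iff]
  have := congrArg Abelianization.of h
  rw [map_mul, map_mul, map_mul, mul_comm] at this
  exact left_eq_mul.1 (mul_left_cancel (this.trans (mul_assoc _ _ _)))

theorem quadratic_mem {g : Cremona2} (h0 : g X0 = X0) (h1 : g X1 = X0 * X1) :
    g ∈ commutator Cremona2 := by
  obtain ⟨t, t0, t1⟩ := exists_translation 1
  obtain ⟨u, u0, u1⟩ := exists_moebius0
  obtain ⟨c, c0, c1⟩ := exists_moebius_mul
  have h : t * g = c * g * t := by
    apply cremona_ext
    · simp [h0, t0, c0]
    · simp [h1, t0, t1, c0, c1]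
      field_simp [X0_ne_zero]
  refine mem_commutator_of_conj (u := u) (b := c) ?_ (mem_commutator_of_mul_eq_mul h)
  apply cremona_ext
  · simp [h0, u0, c0]
  · simp [h1, u0, u1, c1]

theorem scaling_mem {g : Cremona2} {c : ℂ} (hc : c ≠ 0) (h0 : g X0 = X0)
    (h1 : g X1 = algebraMap ℂ K2 c * X1) : g ∈ commutator Cremona2 := by
  obtain ⟨m, m0, m1⟩ := exists_mul
  obtain ⟨u, u0, u1⟩ := exists_scaling hc (one_ne_zero : (1 : ℂ) ≠ 0)
  refine mem_commutator_of_mul_eq_mul (a := u) (b := m) ?_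
  apply cremona_ext
  · simp [h0, u0, m0]
  · simp [h0, h1, u0, u1, m1]
    ring

theorem swap_mem {g : Cremona2} (h0 : g X0 = X1) (h1 : g X1 = X0) : g ∈ commutator Cremona2 := by
  obtain ⟨p, p0, p1⟩ := exists_diagonalize
  obtain ⟨e, e0, e1⟩ := exists_scaling (one_ne_zero : (1 : ℂ) ≠ 0) (by simp : (-1 : ℂ) ≠ 0)
  have he : e ∈ commutator Cremona2 := scaling_mem (by simp) (by simpa using e0) e1
  refine mem_commutator_of_conj (u := p⁻¹) (b := e) ?_ he
  rw [inv_mul_eq_iff_eq_mul, ← mul_assoc, eq_mul_inv_iff_mul_eq]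
  apply cremona_ext <;> simp [h0, h1, p0, p1, e0, e1, add_comm, sub_eq_add_neg]

theorem inversion_mem {g : Cremona2} (h0 : g X0 = X0) (h1 : g X1 = X1⁻¹) :
    g ∈ commutator Cremona2 := by
  obtain ⟨p, p0, p1⟩ := exists_moebius1
  obtain ⟨e, e0, e1⟩ := exists_scaling (one_ne_zero : (1 : ℂ) ≠ 0) (by simp : (-1 : ℂ) ≠ 0)
  have he : e ∈ commutator Cremona2 := scaling_mem (by simp) (by simpa using e0) e1
  refine mem_commutator_of_conj (u := p⁻¹) (b := e) ?_ he
  rw [inv_mul_eq_iff_eq_mul, ← mul_assoc, eq_mul_inv_iff_mul_eq]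
  apply cremona_ext
  · simp [h0, p0, e0]
  · simp [h1, p1, e1]
    have h := X1_sub_one_ne_zero
    have h' := X1_ne_zero
    have : X1⁻¹ - 1 ≠ 0 := by
      intro h''
      apply h
      field_simp at h''
      linear_combination - h''
    have h3 : 1 - X1 ≠ 0 := by rw [← neg_sub]; exact neg_ne_zero.2 h
    have : (X1⁻¹ + 1) / (X1⁻¹ - 1) = (1 + X1) / (1 - X1) := by
      field_simp
    rw [this]
    field_simp
    ring

/-! ### Coordinate pairs -/

/-- The pair `(x, y)` is the image of the coordinates under an element of `H`. -/
def Coord (H : Subgroup Cremona2) (x y : K2) : Prop :=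
  ∃ g ∈ H, g X0 = x ∧ g X1 = y

section Coord

variable {H : Subgroup Cremona2} {x y : K2}

theorem Coord.jac_ne_zero (h : Coord H x y) : Jac x y ≠ 0 := by
  obtain ⟨g, -, rfl, rfl⟩ := h
  exact Jac_auto_ne_zero g

theorem Coord.left_ne_zero (h : Coord H x y) : x ≠ 0 := by
  obtain ⟨g, -, rfl, rfl⟩ := h
  simpa using X0_ne_zero

theorem Coord.right_ne_zero (h : Coord H x y) : y ≠ 0 := by
  obtain ⟨g, -, rfl, rfl⟩ := h
  simpa using X1_ne_zero

theorem Coord.mono {H' : Subgroup Cremona2} (hH : H ≤ H') (h : Coord H x y) : Coord H' x y := by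
  obtain ⟨g, hg, h⟩ := h
  exact ⟨g, hH hg, h⟩

theorem coord_swap_iff (hH : commutator Cremona2 ≤ H) : Coord H y x ↔ Coord H x y := by
  have key : ∀ {x y : K2}, Coord H x y → Coord H y x := by
    rintro x y ⟨g, hg, rfl, rfl⟩
    obtain ⟨m, m0, m1⟩ := exists_swap
    exact ⟨g * m, H.mul_mem hg (hH (swap_mem m0 m1)), by simp [m0], by simp [m1]⟩
  exact ⟨key, key⟩

theorem coord_inv_right_iff (hH : commutator Cremona2 ≤ H) : Coord H x y⁻¹ ↔ Coord H x y := by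
  have key : ∀ {x y : K2}, Coord H x y → Coord H x y⁻¹ := by
    rintro x y ⟨g, hg, rfl, rfl⟩
    obtain ⟨m, m0, m1⟩ := exists_inv
    exact ⟨g * m, H.mul_mem hg (hH (inversion_mem m0 m1)), by simp [m0], by simp [m1]⟩
  exact ⟨fun h => by simpa using key h, key⟩

theorem coord_inv_left_iff (hH : commutator Cremona2 ≤ H) : Coord H x⁻¹ y ↔ Coord H x y := by
  rw [coord_swap_iff hH, coord_inv_right_iff hH, coord_swap_iff hH]

theorem Coord.mul (hH : commutator Cremona2 ≤ H) (h : Coord H x y) : Coord H x (y * x) := by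
  obtain ⟨g, hg, rfl, rfl⟩ := h
  obtain ⟨m, m0, m1⟩ := exists_mul
  exact ⟨g * m, H.mul_mem hg (hH (quadratic_mem m0 m1)), by simp [m0],
    by simp [m1, mul_comm]⟩

theorem Coord.div (hH : commutator Cremona2 ≤ H) (h : Coord H x y) : Coord H x (y / x) := by
  rw [← coord_inv_right_iff hH] at h ⊢
  convert h.mul hH using 1
  rw [div_eq_mul_inv, mul_inv, inv_inv]

theorem Coord.mul_zpow (hH : commutator Cremona2 ≤ H) (h : Coord H x y) (n : ℤ) :
    Coord H x (y * x ^ n) := by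
  have hx := h.left_ne_zero
  induction n with
  | zero => simpa using h
  | succ n ih => rw [zpow_add_one₀ hx, ← mul_assoc]; exact ih.mul hH
  | pred n ih => rw [zpow_sub_one₀ hx, ← mul_assoc, ← div_eq_mul_inv]; exact ih.div hH

theorem coord_mul_zpow_iff (hH : commutator Cremona2 ≤ H) (hx : x ≠ 0) (n : ℤ) :
    Coord H x (y * x ^ n) ↔ Coord H x y := by
  refine ⟨fun h => ?_, fun h => h.mul_zpow hH n⟩
  have := h.mul_zpow hH (-n)
  rwa [mul_assoc, ← zpow_add₀ hx, add_neg_cancel, zpow_zero, mul_one] at this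

theorem coord_div_iff (hH : commutator Cremona2 ≤ H) (hx : x ≠ 0) :
    Coord H x (y / x) ↔ Coord H x y := by
  rw [← coord_mul_zpow_iff (y := y) hH hx (-1), zpow_neg_one, div_eq_mul_inv]

theorem coord_add_left_iff (hH : commutator Cremona2 ≤ H) (s : ℂ) :
    Coord H (x + algebraMap ℂ K2 s) y ↔ Coord H x y := by
  have key : ∀ {s : ℂ} {x y : K2}, Coord H x y → Coord H (x + algebraMap ℂ K2 s) y := by
    rintro s x y ⟨g, hg, rfl, rfl⟩
    obtain ⟨m, m0, m1⟩ := exists_translation s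
    exact ⟨g * m, H.mul_mem hg (hH (translation_mem m0 m1)), by simp [m0], by simp [m1]⟩
  refine ⟨fun h => ?_, key⟩
  simpa using key (s := -s) h

theorem coord_add_right_iff (hH : commutator Cremona2 ≤ H) (s : ℂ) :
    Coord H x (y + algebraMap ℂ K2 s) ↔ Coord H x y := by
  rw [coord_swap_iff hH, coord_add_left_iff hH, coord_swap_iff hH]

theorem coord_sub_left_iff (hH : commutator Cremona2 ≤ H) (s : ℂ) :
    Coord H (x - algebraMap ℂ K2 s) y ↔ Coord H x y := by
  rw [← coord_add_left_iff hH s, sub_add_cancel]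

theorem coord_sub_right_iff (hH : commutator Cremona2 ≤ H) (s : ℂ) :
    Coord H x (y - algebraMap ℂ K2 s) ↔ Coord H x y := by
  rw [← coord_add_right_iff hH s, sub_add_cancel]

theorem coord_scale_right_iff (hH : commutator Cremona2 ≤ H) {c : ℂ} (hc : c ≠ 0) :
    Coord H x (algebraMap ℂ K2 c * y) ↔ Coord H x y := by
  have key : ∀ {c : ℂ} {x y : K2}, c ≠ 0 → Coord H x y → Coord H x (algebraMap ℂ K2 c * y) := by
    rintro c x y hc ⟨g, hg, rfl, rfl⟩
    obtain ⟨m, m0, m1⟩ := exists_scaling one_ne_zero hc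
    exact ⟨g * m, H.mul_mem hg (hH (scaling_mem hc (by simpa using m0) m1)), by simp [m0],
      by simp [m1]⟩
  refine ⟨fun h => ?_, key hc⟩
  have := key (inv_ne_zero hc) h
  rwa [← mul_assoc, ← map_mul, inv_mul_cancel₀ hc, map_one, one_mul] at this

theorem coord_scale_left_iff (hH : commutator Cremona2 ≤ H) {c : ℂ} (hc : c ≠ 0) :
    Coord H (algebraMap ℂ K2 c * x) y ↔ Coord H x y := by
  rw [coord_swap_iff hH, coord_scale_right_iff hH hc, coord_swap_iff hH]

/-- Shears in the second coordinate. -/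
theorem coord_shear_iff (hH : commutator Cremona2 ≤ H) (hx : x ≠ 0) (c : ℂ) :
    Coord H x (y + algebraMap ℂ K2 c * x) ↔ Coord H x y := by
  rw [← coord_div_iff hH hx, add_div, mul_div_cancel_right₀ _ hx, coord_add_right_iff hH,
    coord_div_iff hH hx]

end Coord

/-! ### The global Noether–Fano inequality -/

theorem X_zero_prime : Prime (X 0 : R2) := X_prime

theorem algebraMap_monomial (m : Fin 2 →₀ ℕ) (c : ℂ) :
    algebraMap R2 K2 (monomial m c) = algebraMap ℂ K2 c * X0 ^ m 0 * X1 ^ m 1 := by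
  rw [monomial_eq, Finsupp.prod_fintype _ _ (by simp), Fin.prod_univ_two, map_mul, map_mul,
    map_pow, map_pow, mul_assoc]
  rfl

theorem one_le_of_projective {τ : Cremona2} (h0 : τ X0 = X0⁻¹) (h1 : τ X1 = X1 * X0⁻¹)
    {r : R2} (hr : r ≠ 0) : 1 ≤ (twistedVal (X 0) X_zero_prime τ).v (algebraMap R2 K2 r) := by
  change 1 ≤ primeVal (X 0) X_zero_prime (τ (algebraMap R2 K2 r))
  obtain ⟨m', hm', hmax⟩ := Finset.exists_max_image r.support (fun m => m 0 + m 1)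
    (support_nonempty.2 hr)
  set d := m' 0 + m' 1 with hd
  let q : R2 := ∑ m ∈ r.support,
    monomial (Finsupp.single 0 (d - (m 0 + m 1)) + Finsupp.single 1 (m 1)) (coeff m r)
  have hq : ¬ X 0 ∣ q := by
    rintro ⟨q', hq'⟩
    have e := congrArg (coeff (Finsupp.single 1 (m' 1))) hq'
    rw [coeff_X_mul', if_neg (by simp)] at e
    rw [coeff_sum, Finset.sum_eq_single m'] at e
    · rw [coeff_monomial, if_pos (by simp [hd])] at e
      exact mem_support_iff.1 hm' e
    · intro m hm hne
      rw [coeff_monomial, if_neg]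
      intro hc
      apply hne
      have c0 := DFunLike.congr_fun hc 0
      have c1 := DFunLike.congr_fun hc 1
      simp at c0 c1
      have := hmax m hm
      ext i; fin_cases i
      · simp; omega
      · exact c1
    · exact fun h => absurd hm' h
  have e : τ (algebraMap R2 K2 r) = algebraMap R2 K2 q * (X0 ^ d)⁻¹ := by
    conv_lhs => rw [r.as_sum]
    simp only [q, map_sum]
    rw [Finset.sum_mul]
    refine Finset.sum_congr rfl fun m hm => ?_
    have hle := hmax m hm
    have hX := X0_ne_zero
    rw [algebraMap_monomial, algebraMap_monomial]
    simp only [map_mul, map_pow, h0, h1, AlgEquiv.commutes]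
    simp
    obtain ⟨k, hk⟩ := Nat.exists_eq_add_of_le hle
    rw [hk, Nat.add_sub_cancel_left, pow_add, pow_add, mul_pow, inv_pow]
    field_simp
  have hX : primeVal (X 0) X_zero_prime X0 = exp (-1) := primeVal_self _
  rw [e, map_mul, primeVal_algebraMap_eq_one _ hq, one_mul, map_inv₀, map_pow, hX, ← exp_nsmul,
    ← exp_neg, ← exp_zero, exp_le_exp]
  simp

theorem noether_fano {x y h : K2} (hJ : Jac x y ≠ 0) (hh : h ≠ 0) {A B : ℕ} (hAB : B < 3 * A)
    (H : ∀ w : DivVal, ∃ k ∈ ({h, X0 * h, X1 * h} : Set K2),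
      w.v (w.θ * Jac x y) ^ A ≤ w.v k ^ B) : False := by
  have hv : ∀ v : Valuation K2 ℤᵐ⁰, v h ≠ 0 := fun v => v.ne_zero_iff.2 hh
  obtain ⟨r, hr⟩ : ∃ r : R2, algebraMap R2 K2 r = Jac x y ^ A / h ^ B := by
    apply mem_range_of_primeVal_le_one
    intro p hp
    obtain ⟨k, hk, hle⟩ := H (affineVal p hp)
    have h1 : (affineVal p hp).v k ≤ (affineVal p hp).v h := by
      rcases hk with rfl | rfl | rfl
      · rfl
      · rw [map_mul]; exact mul_le_of_le_one_left' (primeVal_algebraMap_le_one hp _)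
      · rw [map_mul]; exact mul_le_of_le_one_left' (primeVal_algebraMap_le_one hp _)
    rw [map_div₀, map_pow, map_pow]
    refine (div_le_one₀ (zero_lt_iff.2 (pow_ne_zero _ (hv _)))).2 ?_
    have e : (affineVal p hp).θ = 1 := rfl
    rw [e, one_mul] at hle
    exact hle.trans (pow_le_pow_left' h1 B)
  have hr0 : r ≠ 0 := by
    rintro rfl
    rw [map_zero, eq_comm] at hr
    exact div_ne_zero (pow_ne_zero _ hJ) (pow_ne_zero _ hh) hr
  obtain ⟨τ, -, h0, h1⟩ : Coord ⊤ X0⁻¹ (X1 * X0⁻¹) := by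
    have : Coord ⊤ X0 X1 := ⟨1, trivial, rfl, rfl⟩
    rw [coord_inv_left_iff le_top, ← div_eq_mul_inv]
    exact this.div le_top
  have hone := one_le_of_projective h0 h1 hr0
  set w := twistedVal (X 0) X_zero_prime τ with hw
  have hX : primeVal (X 0) X_zero_prime X0 = exp (-1) := primeVal_self _
  have hY : primeVal (X 0) X_zero_prime X1 = 1 := by
    apply primeVal_algebraMap_eq_one
    rintro ⟨q, hq⟩
    have := congrArg (coeff (Finsupp.single 1 1)) hq
    rw [coeff_X_mul', if_neg (by simp)] at this
    simp at this
  have w0 : w.v X0 = exp 1 := by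
    change primeVal (X 0) X_zero_prime (τ X0) = _
    rw [h0, map_inv₀, hX, ← exp_neg]; rfl
  have w1 : w.v X1 = exp 1 := by
    change primeVal (X 0) X_zero_prime (τ X1) = _
    rw [h1, map_mul, map_inv₀, hX, hY, ← exp_neg, one_mul]; rfl
  have wθ : w.v w.θ = exp 3 := by
    change primeVal (X 0) X_zero_prime (τ (τ.symm (Jac (τ X0) (τ X1)))) = _
    rw [τ.apply_symm_apply, h0, h1]
    have := Jac_inv_mul_zpow X0 X1 X0_ne_zero 1
    rw [zpow_neg_one] at this
    rw [this, Jac_X0_X1, mul_one, Valuation.map_neg, map_zpow₀, hX, ← exp_zsmul]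
    rfl
  obtain ⟨k, hk, hle⟩ := H w
  have hk' : w.v k ≤ exp 1 * w.v h := by
    rcases hk with rfl | rfl | rfl
    · exact le_mul_of_one_le_left' (by rw [← exp_zero, exp_le_exp]; norm_num)
    · rw [map_mul, w0]
    · rw [map_mul, w1]
  have hle' := hle.trans (pow_le_pow_left' hk' B)
  rw [map_mul, wθ, mul_pow, mul_pow] at hle'
  rw [hr, map_div₀, map_pow, map_pow, one_le_div₀ (zero_lt_iff.2 (pow_ne_zero _ (hv _)))] at hone
  have h3 := (mul_le_mul_right hone (exp 3 ^ A)).trans hle'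
  have h4 := (mul_le_mul_iff_left₀ (zero_lt_iff.2 (pow_ne_zero _ (hv _)))).1 h3
  rw [← exp_nsmul, ← exp_nsmul, exp_le_exp] at h4
  simp at h4
  omega

/-! ### Restriction to the line `x = 0` -/

/-- Restriction of polynomials to the line `x = 0`. -/
def restrict : R2 →ₐ[ℂ] Polynomial ℂ := aeval ![0, Polynomial.X]

theorem exists_eq_X_mul_add_restrict (P : R2) :
    ∃ R : R2, P = X 0 * R + Polynomial.aeval (X 1) (restrict P) := by
  induction P using MvPolynomial.induction_on with
  | C c => exact ⟨0, by simp [restrict, MvPolynomial.algebraMap_eq]⟩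
  | add p q hp hq =>
    obtain ⟨R, hR⟩ := hp
    obtain ⟨S, hS⟩ := hq
    refine ⟨R + S, ?_⟩
    conv_lhs => rw [hR, hS]
    rw [map_add, map_add]; ring
  | mul_X p i hp =>
    obtain ⟨R, hR⟩ := hp
    fin_cases i
    · refine ⟨p, ?_⟩
      simp [restrict, mul_comm]
    · refine ⟨R * X 1, ?_⟩
      conv_lhs => rw [hR]
      simp [restrict]
      ring

theorem restrict_coeff (P : R2) (j : ℕ) :
    (restrict P).coeff j = coeff (Finsupp.single 1 j) P := by
  induction P using MvPolynomial.induction_on' with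
  | monomial m c =>
    rw [restrict, aeval_monomial, Finsupp.prod_fintype _ _ (by simp), Fin.prod_univ_two,
      coeff_monomial, ← Polynomial.C_eq_algebraMap]
    simp only [Matrix.cons_val_zero, Matrix.cons_val_one, Polynomial.coeff_C_mul]
    by_cases h0 : m 0 = 0
    · rw [h0, pow_zero, one_mul, Polynomial.coeff_X_pow]
      by_cases h1 : j = m 1
      · rw [if_pos h1, if_pos, mul_one]
        ext i; fin_cases i <;> simp [h0, h1]
      · rw [if_neg h1, if_neg, mul_zero]
        intro h
        apply h1
        rw [h]; simp
    · rw [zero_pow h0, zero_mul, Polynomial.coeff_zero, mul_zero, if_neg]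
      intro h
      apply h0
      rw [h]; simp
  | add p q hp hq => rw [map_add, Polynomial.coeff_add, hp, hq, coeff_add]

namespace DivVal

variable (w : DivVal) {x y : K2}

theorem aeval_le_one (hx : w.v x ≤ 1) (hy : w.v y ≤ 1) (P : R2) : w.v (aeval ![x, y] P) ≤ 1 := by
  induction P using MvPolynomial.induction_on with
  | C c => simpa using w.const_le_one c
  | add p q hp hq => rw [map_add]; exact (w.v.map_add _ _).trans (max_le hp hq)
  | mul_X p i hp =>
    rw [map_mul, map_mul]
    refine mul_le_one' hp ?_
    fin_cases i
    · simpa using hx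
    · simpa using hy

theorem aeval_eq_one (hy : w.v y ≤ 1) (h : ∀ t : ℂ, ¬ w.v (y - algebraMap ℂ K2 t) < 1)
    {q : Polynomial ℂ} (hq : q ≠ 0) : w.v (Polynomial.aeval y q) = 1 := by
  rw [(IsAlgClosed.splits q).eq_prod_roots, map_mul, map_mul, Polynomial.aeval_C,
    w.const_eq_one (Polynomial.leadingCoeff_ne_zero.2 hq), one_mul, map_multiset_prod,
    map_multiset_prod, Multiset.map_map, Multiset.map_map]
  refine Multiset.prod_eq_one fun a ha => ?_
  obtain ⟨t, -, rfl⟩ := Multiset.mem_map.1 ha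
  simp only [Function.comp_apply, map_sub, Polynomial.aeval_X, Polynomial.aeval_C]
  refine le_antisymm ((w.v.map_sub _ _).trans (max_le hy (w.const_le_one t))) (not_lt.1 (h t))

/-- If a polynomial vanishes on a center lying on `x = 0` and dominating this line, then it
vanishes on this line. -/
theorem aeval_eq_one_of_restrict_ne_zero (hx : w.v x < 1) (hy : w.v y ≤ 1)
    (h : ∀ t : ℂ, ¬ w.v (y - algebraMap ℂ K2 t) < 1) {P : R2} (hP : restrict P ≠ 0) :
    w.v (aeval ![x, y] P) = 1 := by
  obtain ⟨R, hR⟩ := exists_eq_X_mul_add_restrict P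
  have e : aeval ![x, y] P = x * aeval ![x, y] R + Polynomial.aeval y (restrict P) := by
    conv_lhs => rw [hR]
    rw [map_add, map_mul, ← Polynomial.aeval_algHom_apply]
    simp
  have h1 := w.aeval_eq_one hy h hP
  rw [e, Valuation.map_add_eq_of_lt_right, h1]
  rw [h1, map_mul]
  exact mul_lt_one_of_lt_of_le hx (w.aeval_le_one hx.le hy R)

theorem key_step (n : ℕ)
    (ih : ∀ (x y : K2) (P : R2) (m : Fin 2 →₀ ℕ), w.v x < 1 → w.v y < 1 → Jac x y ≠ 0 →
      coeff m P ≠ 0 → exp (1 - (n : ℤ)) ≤ w.v (w.θ * Jac x y) →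
      w.v (w.θ * Jac x y) ^ (m 0 + m 1) ≤ w.v (aeval ![x, y] P))
    (hx : w.v x < 1) (hyx : w.v y ≤ w.v x) (hJ : Jac x y ≠ 0) {P : R2} {m : Fin 2 →₀ ℕ}
    (hm : coeff m P ≠ 0) (hn : exp (-(n : ℤ)) ≤ w.v (w.θ * Jac x y)) :
    w.v (w.θ * Jac x y) ^ (m 0 + m 1) ≤ w.v (aeval ![x, y] P) := by
  have hx0 : x ≠ 0 := by rintro rfl; simp [Jac] at hJ
  have vx0 : w.v x ≠ 0 := w.v.ne_zero_iff.2 hx0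
  have hy1 : w.v (y / x) ≤ 1 := by
    rw [map_div₀]; exact (div_le_one₀ (zero_lt_iff.2 vx0)).2 hyx
  have hJ1 := Jac_div x y hx0
  have hJ' : Jac x y = x * Jac x (y / x) := by rw [hJ1]; field_simp
  have hθ : w.v (w.θ * Jac x y) = w.v x * w.v (w.θ * Jac x (y / x)) := by
    rw [hJ', ← map_mul]; congr 1; ring
  have hθ1 : w.v (w.θ * Jac x (y / x)) ≤ 1 := w.jac_le_one _ _ hx.le hy1
  have hJ10 : Jac x (y / x) ≠ 0 := by rw [hJ1]; exact div_ne_zero hJ hx0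
  obtain ⟨m', hm', hmin⟩ := Finset.exists_min_image P.support (fun m => m 0 + m 1)
    ⟨m, mem_support_iff.2 hm⟩
  set d := m' 0 + m' 1 with hd
  let Q : R2 := ∑ m ∈ P.support,
    monomial (Finsupp.single 0 (m 0 + m 1 - d) + Finsupp.single 1 (m 1)) (coeff m P)
  have hPQ : aeval ![x, y] P = x ^ d * aeval ![x, y / x] Q := by
    conv_lhs => rw [P.as_sum]
    simp only [Q, map_sum]
    rw [Finset.mul_sum]
    refine Finset.sum_congr rfl fun m hm => ?_
    obtain ⟨k, hk⟩ := Nat.exists_eq_add_of_le (hmin m hm)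
    rw [aeval_monomial, aeval_monomial, Finsupp.prod_fintype _ _ (by simp),
      Finsupp.prod_fintype _ _ (by simp), Fin.prod_univ_two, Fin.prod_univ_two, hk,
      Nat.add_sub_cancel_left]
    simp [div_pow]
    have : x ^ (m 0) * x ^ (m 1) = x ^ d * x ^ k := by rw [← pow_add, ← pow_add, hk]
    field_simp
    linear_combination (algebraMap ℂ K2 (coeff m P)) * y ^ (m 1) * this
  have hcoeff : coeff (Finsupp.single 1 (m' 1)) Q ≠ 0 := by
    rw [coeff_sum, Finset.sum_eq_single m']
    · rw [coeff_monomial, if_pos (by simp [hd])]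
      exact mem_support_iff.1 hm'
    · intro m hm hne
      rw [coeff_monomial, if_neg]
      intro hc
      apply hne
      have c0 := DFunLike.congr_fun hc 0
      have c1 := DFunLike.congr_fun hc 1
      simp at c0 c1
      have := hmin m hm
      ext i; fin_cases i
      · simp; omega
      · exact c1
    · exact fun h => absurd hm' h
  have hdeg : (restrict Q).natDegree ≤ d := by
    rw [Polynomial.natDegree_le_iff_coeff_eq_zero]
    intro N hN
    rw [restrict_coeff, coeff_sum]
    refine Finset.sum_eq_zero fun m hm => ?_
    rw [coeff_monomial, if_neg]
    intro hc
    have c0 := DFunLike.congr_fun hc 0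
    have c1 := DFunLike.congr_fun hc 1
    simp at c0 c1
    omega
  have hQ0 : restrict Q ≠ 0 := by
    intro h
    apply hcoeff
    rw [← restrict_coeff, h, Polynomial.coeff_zero]
  have hfin : w.v (w.θ * Jac x (y / x)) ^ d ≤ w.v (aeval ![x, y / x] Q) := by
    by_cases ht : ∃ t : ℂ, w.v (y / x - algebraMap ℂ K2 t) < 1
    · obtain ⟨t, ht⟩ := ht
      let Q' : R2 := aeval ![X 0, X 1 + C t] Q
      have hQQ' : aeval ![x, y / x] Q = aeval ![x, y / x - algebraMap ℂ K2 t] Q' := by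
        simp only [Q']
        rw [← AlgHom.comp_apply, comp_aeval]
        congr 2
        ext i; fin_cases i <;> simp
      have hres : restrict Q' = (restrict Q).comp (Polynomial.X + Polynomial.C t) := by
        have : restrict.comp (aeval ![X 0, X 1 + C t]) =
            (Polynomial.aeval (R := ℂ) (Polynomial.X + Polynomial.C t)).comp restrict := by
          ext i; fin_cases i <;> simp [restrict, Polynomial.C_eq_algebraMap]
        exact DFunLike.congr_fun this Q
      have hnd : (restrict Q').natDegree ≤ d := by
        rw [hres, Polynomial.natDegree_comp, Polynomial.natDegree_X_add_C, mul_one]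
        exact hdeg
      have hne : restrict Q' ≠ 0 := by
        intro h
        rw [hres, ← Polynomial.taylor_apply] at h
        exact hQ0 ((Polynomial.taylor_injective t) (by simpa using h))
      have hJt : Jac x (y / x - algebraMap ℂ K2 t) = Jac x (y / x) := by
        simpa using Jac_sub_const x (y / x) 0 t
      have h := ih x (y / x - algebraMap ℂ K2 t) Q' (Finsupp.single 1 (restrict Q').natDegree) hx ht
        (by rwa [hJt])
        (by rw [← restrict_coeff]; exact Polynomial.leadingCoeff_ne_zero.2 hne)
        (by
          rw [hJt]
          rw [hθ] at hn
          have : w.v x ≤ exp (-1) := by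
            obtain ⟨k, hk⟩ : ∃ k : ℤ, w.v x = exp k := ⟨_, (exp_log vx0).symm⟩
            rw [hk, ← exp_zero, exp_lt_exp] at hx
            rw [hk, exp_le_exp]
            omega
          have h2 := hn.trans (mul_le_mul_left this _)
          rw [show -(n : ℤ) = -1 + (1 - n) by ring, exp_add] at h2
          exact (mul_le_mul_iff_right₀ exp_pos).1 h2)
      rw [hJt, ← hQQ'] at h
      refine le_trans (pow_le_pow_right_of_le_one' hθ1 ?_) h
      simpa using hnd
    · rw [w.aeval_eq_one_of_restrict_ne_zero hx hy1 (not_exists.1 ht) hQ0]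
      exact pow_le_one' hθ1 d
  rw [hPQ, map_mul w.v (x ^ d), map_pow]
  calc w.v (w.θ * Jac x y) ^ (m 0 + m 1) ≤ w.v (w.θ * Jac x y) ^ d :=
        pow_le_pow_right_of_le_one' (by rw [hθ]; exact mul_le_one' hx.le hθ1)
          (hmin m (mem_support_iff.2 hm))
    _ = w.v x ^ d * w.v (w.θ * Jac x (y / x)) ^ d := by rw [hθ, mul_pow]
    _ ≤ _ := mul_le_mul_right hfin _

theorem pow_jac_le_aeval (hx : w.v x < 1) (hy : w.v y < 1) (hJ : Jac x y ≠ 0) {P : R2}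
    {m : Fin 2 →₀ ℕ} (hm : coeff m P ≠ 0) :
    w.v (w.θ * Jac x y) ^ (m 0 + m 1) ≤ w.v (aeval ![x, y] P) := by
  have key : ∀ (n : ℕ) (x y : K2) (P : R2) (m : Fin 2 →₀ ℕ), w.v x < 1 → w.v y < 1 → Jac x y ≠ 0 →
      coeff m P ≠ 0 → exp (1 - (n : ℤ)) ≤ w.v (w.θ * Jac x y) →
      w.v (w.θ * Jac x y) ^ (m 0 + m 1) ≤ w.v (aeval ![x, y] P) := by
    intro n
    induction n with
    | zero =>
      intro x y P m hx hy hJ hm hn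
      have := hn.trans (w.jac_le_one x y hx.le hy.le)
      rw [← exp_zero, exp_le_exp] at this
      simp at this
    | succ n ih =>
      intro x y P m hx hy hJ hm hn
      rcases le_total (w.v y) (w.v x) with h | h
      · exact w.key_step n ih hx h hJ hm (by simpa using hn)
      · have hs : Jac y x ≠ 0 := by rw [Jac_swap]; exact neg_ne_zero.2 hJ
        have hv : w.v (w.θ * Jac y x) = w.v (w.θ * Jac x y) := by
          rw [Jac_swap, mul_neg, Valuation.map_neg]
        have := w.key_step n ih (P := rename (Equiv.swap 0 1) P)
          (m := m.mapDomain (Equiv.swap 0 1)) hy h hs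
          (by rwa [coeff_rename_mapDomain _ (Equiv.injective _)]) (by rw [hv]; simpa using hn)
        rw [hv, aeval_rename] at this
        convert this using 2
        · rw [add_comm]
          congr 1
          · exact (Finsupp.mapDomain_apply (Equiv.injective _) m 1).symm
          · exact (Finsupp.mapDomain_apply (Equiv.injective _) m 0).symm
        · congr 2
          ext i; fin_cases i <;> simp
  have h0 : w.v (w.θ * Jac x y) ≠ 0 := w.v.ne_zero_iff.2 (mul_ne_zero w.θ_ne_zero hJ)
  refine key (1 - log (w.v (w.θ * Jac x y))).toNat x y P m hx hy hJ hm ?_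
  rw [← le_log_iff_exp_le h0]
  omega

end DivVal

/-! ### Linear systems -/

/-- The linear system spanned by the monomials in `x` and `y` with exponents in `S`. -/
def sys (S : ℕ → ℕ → Prop) (x y : K2) : Submodule ℂ K2 :=
  Submodule.span ℂ {h | ∃ i j, S i j ∧ h = x ^ i * y ^ j}

section sys

variable {S S' : ℕ → ℕ → Prop} {x y x' y' k c : K2}

theorem monomial_mem_sys {i j : ℕ} (h : S i j) : x ^ i * y ^ j ∈ sys S x y :=
  Submodule.subset_span ⟨i, j, h, rfl⟩

theorem algebraMap_mul_mem {M : Submodule ℂ K2} (hk : k ∈ M) (s : ℂ) :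
    algebraMap ℂ K2 s * k ∈ M := by
  rw [← Algebra.smul_def]; exact M.smul_mem s hk

theorem mul_mem_of_mem_sys {M : Submodule ℂ K2} (hM : ∀ i j, S i j → c * (x ^ i * y ^ j) ∈ M)
    (hk : k ∈ sys S x y) : c * k ∈ M := by
  induction hk using Submodule.span_induction with
  | mem h hh =>
    obtain ⟨i, j, hij, rfl⟩ := hh
    exact hM i j hij
  | zero => simp
  | add a b _ _ ha hb => rw [mul_add]; exact M.add_mem ha hb
  | smul s a _ ha => rw [mul_smul_comm]; exact M.smul_mem s ha

theorem mem_of_mem_sys {M : Submodule ℂ K2} (hM : ∀ i j, S i j → x ^ i * y ^ j ∈ M)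
    (hk : k ∈ sys S x y) : k ∈ M := by
  simpa using mul_mem_of_mem_sys (c := 1) (by simpa using hM) hk

theorem sys_mono (h : ∀ i j, S i j → S' i j) (hk : k ∈ sys S x y) : k ∈ sys S' x y :=
  mem_of_mem_sys (fun i j hij => monomial_mem_sys (h i j hij)) hk

theorem mem_sys_iff : k ∈ sys S x y ↔
    ∃ P : R2, (∀ m ∈ P.support, S (m 0) (m 1)) ∧ aeval ![x, y] P = k := by
  constructor
  · intro hk
    induction hk using Submodule.span_induction with
    | mem h hh =>
      obtain ⟨i, j, hij, rfl⟩ := hh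
      refine ⟨monomial (Finsupp.single 0 i + Finsupp.single 1 j) 1, ?_, ?_⟩
      · intro m hm
        rw [mem_support_iff, coeff_monomial] at hm
        split_ifs at hm with h
        · rw [← h]; simpa using hij
        · simp at hm
      · simp [aeval_monomial, Finsupp.prod_fintype]
    | zero => exact ⟨0, by simp, by simp⟩
    | add a b _ _ ha hb =>
      obtain ⟨P, hP, rfl⟩ := ha
      obtain ⟨Q, hQ, rfl⟩ := hb
      refine ⟨P + Q, fun m hm => ?_, by simp⟩
      rcases Finset.mem_union.1 (support_add hm) with h | h
      exacts [hP m h, hQ m h]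
    | smul s a _ ha =>
      obtain ⟨P, hP, rfl⟩ := ha
      exact ⟨s • P, fun m hm => hP m (support_smul hm), by simp⟩
  · rintro ⟨P, hP, rfl⟩
    rw [P.as_sum, map_sum]
    refine Submodule.sum_mem _ fun m hm => ?_
    rw [aeval_monomial, Finsupp.prod_fintype _ _ (by simp), Fin.prod_univ_two]
    exact algebraMap_mul_mem (monomial_mem_sys (hP m hm)) _

theorem sys_swap (hk : k ∈ sys S x y) : k ∈ sys (fun i j => S j i) y x :=
  mem_of_mem_sys (fun i j hij => by
    rw [mul_comm]
    exact monomial_mem_sys (S := fun i j => S j i) hij) hk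

theorem sys_sub_left (hS : ∀ i i' j, i' ≤ i → S i j → S i' j) (s : ℂ) (hk : k ∈ sys S x y) :
    k ∈ sys S (x - algebraMap ℂ K2 s) y := by
  refine mem_of_mem_sys (fun i j hij => ?_) hk
  have e : x ^ i = ((x - algebraMap ℂ K2 s) + algebraMap ℂ K2 s) ^ i := by rw [sub_add_cancel]
  rw [e, add_pow, Finset.sum_mul]
  refine Submodule.sum_mem _ fun m hm => ?_
  have h := monomial_mem_sys (x := x - algebraMap ℂ K2 s) (y := y)
    (hS i m j (Nat.le_of_lt_succ (Finset.mem_range.1 hm)) hij)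
  have h' := algebraMap_mul_mem h (s ^ (i - m) * (i.choose m))
  convert h' using 1
  simp only [map_mul, map_pow, map_natCast]
  ring

theorem sys_sub_right (hS : ∀ i j j', j' ≤ j → S i j → S i j') (s : ℂ) (hk : k ∈ sys S x y) :
    k ∈ sys S x (y - algebraMap ℂ K2 s) :=
  sys_swap (sys_sub_left (S := fun i j => S j i) (fun i i' j => hS j i i') s (sys_swap hk))

end sys

/-- Homogeneous coordinates of the target point `(X0, X1)`, scaled by `h`. -/
def triple (h : K2) : Set K2 := {h, X0 * h, X1 * h}

theorem self_mem_triple (h : K2) : h ∈ triple h := Or.inl rfl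

theorem forall_triple_mul {c h : K2} {p : K2 → Prop} (H : ∀ k ∈ triple h, p (c * k)) :
    ∀ k ∈ triple (c * h), p k := by
  rintro k (rfl | rfl | rfl)
  · exact H _ (Or.inl rfl)
  · rw [mul_left_comm]; exact H _ (Or.inr (Or.inl rfl))
  · rw [mul_left_comm]; exact H _ (Or.inr (Or.inr rfl))

/-- In the coordinates `(x, y)`, the birational map `(X0, X1)` is given by polynomials with
exponents in `S`. -/
def State (S : ℕ → ℕ → Prop) (x y : K2) : Prop :=
  ∃ h : K2, h ≠ 0 ∧ ∀ k ∈ triple h, k ∈ sys S x y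

theorem State.transform {S S' : ℕ → ℕ → Prop} {x y x' y' : K2} (c : K2) (hc : c ≠ 0)
    (H : ∀ i j, S i j → c * (x ^ i * y ^ j) ∈ sys S' x' y') (h : State S x y) : State S' x' y' := by
  obtain ⟨h, h0, hh⟩ := h
  exact ⟨c * h, mul_ne_zero hc h0,
    forall_triple_mul fun k hk => mul_mem_of_mem_sys H (hh k hk)⟩

/-- The valuation `w` violates the Noether–Fano inequality for the linear system spanned by
`triple h` with respect to the coordinates `(x, y)`. -/
def Violates (w : DivVal) (h x y : K2) (A B : ℕ) : Prop :=
  ∀ k ∈ triple h, w.v k ^ B < w.v (w.θ * Jac x y) ^ A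

theorem exists_violates {x y h : K2} (hJ : Jac x y ≠ 0) (hh : h ≠ 0) {A B : ℕ}
    (hAB : B < 3 * A) : ∃ w : DivVal, Violates w h x y A B := by
  by_contra hc
  refine noether_fano hJ hh hAB fun w => ?_
  have := not_exists.1 hc w
  simp only [Violates, not_forall, not_lt] at this
  obtain ⟨k, hk, h⟩ := this
  exact ⟨k, hk, h⟩

theorem Violates.transform {w : DivVal} {h x y : K2} {A B : ℕ} (H : Violates w h x y A B)
    {c e x' y' : K2} (hc : c ≠ 0) (he : Jac x' y' = e * Jac x y)
    (hce : w.v c ^ B ≤ w.v e ^ A) : Violates w (c * h) x' y' A B := by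
  refine forall_triple_mul fun k hk => ?_
  have e1 : w.v (w.θ * Jac x' y') = w.v e * w.v (w.θ * Jac x y) := by
    rw [he, ← map_mul]; congr 1; ring
  rw [map_mul, mul_pow, e1, mul_pow]
  refine lt_of_lt_of_le ?_ (mul_le_mul_left hce _)
  exact (mul_lt_mul_iff_right₀ (zero_lt_iff.2 (pow_ne_zero _ (w.v.ne_zero_iff.2 hc)))).2 (H k hk)

/-! ### Centers of valuations -/

namespace DivVal

variable (w : DivVal) {x y h : K2} {A B : ℕ} {S : ℕ → ℕ → Prop}

theorem lt_one_of_violates (hx : w.v x ≤ 1) (hy : w.v y ≤ 1) (hV : Violates w h x y A B)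
    {k : K2} (hk : k ∈ triple h) : w.v k < 1 := by
  by_contra hc
  have h1 := (one_le_pow_of_one_le' (not_lt.1 hc) B).trans_lt (hV k hk)
  exact absurd (pow_le_one' (w.jac_le_one x y hx hy) A) (not_le.2 h1)

theorem mem_sys_of_center_point (hx : w.v x < 1) (hy : w.v y < 1) (hJ : Jac x y ≠ 0)
    (hV : Violates w h x y A B) {k : K2} (hk : k ∈ triple h) (hS : k ∈ sys S x y) :
    k ∈ sys (fun i j => S i j ∧ A < B * (i + j)) x y := by
  rw [mem_sys_iff] at hS ⊢
  obtain ⟨P, hP, rfl⟩ := hS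
  refine ⟨P, fun m hm => ⟨hP m hm, ?_⟩, rfl⟩
  have h1 := w.pow_jac_le_aeval hx hy hJ (mem_support_iff.1 hm)
  have h2 := (pow_le_pow_left' h1 B).trans_lt (hV _ hk)
  rw [← pow_mul, mul_comm (m 0 + m 1)] at h2
  by_contra hc
  have := pow_le_pow_right_of_le_one' (w.jac_le_one x y hx.le hy.le) (not_lt.1 hc)
  exact absurd this (not_le.2 h2)

theorem mem_sys_of_center_line (hx : w.v x < 1) (hy : w.v y ≤ 1)
    (ht : ∀ t : ℂ, ¬ w.v (y - algebraMap ℂ K2 t) < 1)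
    (hV : Violates w h x y A B) {k : K2} (hk : k ∈ triple h) (hS : k ∈ sys S x y) :
    k ∈ sys (fun i j => S i j ∧ 1 ≤ i) x y := by
  have hk1 := w.lt_one_of_violates hx.le hy hV hk
  rw [mem_sys_iff] at hS ⊢
  obtain ⟨P, hP, rfl⟩ := hS
  refine ⟨P, fun m hm => ⟨hP m hm, ?_⟩, rfl⟩
  have h0 : restrict P = 0 := by
    by_contra hc
    exact hk1.ne (w.aeval_eq_one_of_restrict_ne_zero hx hy ht hc)
  by_contra hc
  apply mem_support_iff.1 hm
  have e : m = Finsupp.single 1 (m 1) := by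
    ext i; fin_cases i
    · simp; omega
    · simp
  rw [e, ← restrict_coeff, h0, Polynomial.coeff_zero]

end DivVal

/-! ### Centers of valuations that are curves -/

theorem isMaximal_of_lt_of_lt {I J : Ideal R2} [hI : I.IsPrime] [hJ : J.IsPrime] (h0 : ⊥ < J)
    (h1 : J < I) : I.IsMaximal := by
  obtain ⟨M, hM, hIM⟩ := Ideal.exists_le_maximal I hI.ne_top
  rcases hIM.eq_or_lt with rfl | hlt
  · exact hM
  exfalso
  have hMp := hM.isPrime
  let a : PrimeSpectrum R2 := ⟨⊥, Ideal.isPrime_bot⟩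
  let b : PrimeSpectrum R2 := ⟨J, hJ⟩
  let c : PrimeSpectrum R2 := ⟨I, hI⟩
  let d : PrimeSpectrum R2 := ⟨M, hMp⟩
  have hab : a < b := h0
  have hbc : b < c := h1
  have hcd : c < d := hlt
  let l : LTSeries (PrimeSpectrum R2) :=
    { length := 3
      toFun := ![a, b, c, d]
      step := fun i => by
        fin_cases i
        exacts [hab, hbc, hcd] }
  have hl := Order.LTSeries.length_le_krullDim l
  have hd : Order.krullDim (PrimeSpectrum R2) = 2 := by
    change ringKrullDim R2 = 2
    rw [MvPolynomial.ringKrullDim_of_isNoetherianRing, ringKrullDim_eq_zero_of_field]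
    simp
  have h3 : l.length = 3 := rfl
  rw [hd, h3] at hl
  exact absurd hl (by decide)

theorem eq_aeval_of_degreeOf_eq_zero {p : R2} (h : degreeOf 1 p = 0) :
    ∃ q : Polynomial ℂ, p = Polynomial.aeval (X 0) q := by
  refine ⟨aeval ![Polynomial.X, 0] p, ?_⟩
  rw [p.as_sum, map_sum, map_sum]
  refine Finset.sum_congr rfl fun m hm => ?_
  have h1 : m 1 = 0 := Nat.le_zero.1 (h ▸ monomial_le_degreeOf 1 hm)
  rw [aeval_monomial, Finsupp.prod_fintype _ _ (by simp), Fin.prod_univ_two, monomial_eq,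
    Finsupp.prod_fintype _ _ (by simp), Fin.prod_univ_two, h1]
  simp [MvPolynomial.algebraMap_eq]

namespace DivVal

variable (w : DivVal) {x y : K2}

/-- The ideal of polynomials vanishing on the center of a valuation. -/
def center (hx : w.v x ≤ 1) (hy : w.v y ≤ 1) : Ideal R2 where
  carrier := {P | w.v (aeval ![x, y] P) < 1}
  zero_mem' := by simp
  add_mem' ha hb := by
    change w.v _ < 1
    rw [map_add]
    exact (w.v.map_add _ _).trans_lt (max_lt ha hb)
  smul_mem' c a ha := by
    change w.v _ < 1
    rw [smul_eq_mul, map_mul, map_mul]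
    exact (mul_le_of_le_one_left' (w.aeval_le_one hx hy c)).trans_lt ha

theorem mem_center (hx : w.v x ≤ 1) (hy : w.v y ≤ 1) (P : R2) :
    P ∈ w.center hx hy ↔ w.v (aeval ![x, y] P) < 1 := Iff.rfl

theorem center_isPrime (hx : w.v x ≤ 1) (hy : w.v y ≤ 1) : (w.center hx hy).IsPrime := by
  refine ⟨(Ideal.ne_top_iff_one _).2 ?_, fun {a b} h => ?_⟩
  · rw [mem_center]; simp
  · rw [mem_center] at *
    rw [mem_center]
    by_contra hc
    rw [not_or, not_lt, not_lt] at hc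
    rw [map_mul, map_mul] at h
    exact absurd (one_le_mul hc.1 hc.2) (not_le.2 h)

theorem exists_prime_of_center_curve (hx : w.v x ≤ 1) (hy : w.v y ≤ 1)
    (hs : ∀ s : ℂ, ¬ w.v (x - algebraMap ℂ K2 s) < 1) {P : R2} (hP : P ≠ 0)
    (hPv : w.v (aeval ![x, y] P) < 1) :
    ∃ p : R2, p ≠ 0 ∧ degreeOf 1 p ≠ 0 ∧ ∀ Q : R2, w.v (aeval ![x, y] Q) < 1 → p ∣ Q := by
  have hI := w.center_isPrime hx hy
  obtain ⟨p, hpI, hp⟩ := Ideal.IsPrime.exists_mem_prime_of_ne_bot hI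
    (fun h => hP ((Submodule.mem_bot R2).1 (h ▸ (w.mem_center hx hy P).2 hPv)))
  refine ⟨p, hp.ne_zero, fun h => ?_, fun Q hQ => ?_⟩
  · obtain ⟨q, rfl⟩ := eq_aeval_of_degreeOf_eq_zero h
    rw [mem_center, ← Polynomial.aeval_algHom_apply] at hpI
    have hq : q ≠ 0 := by rintro rfl; exact hp.ne_zero (map_zero _)
    have := w.aeval_eq_one hx hs hq
    simp at hpI
    exact hpI.ne this
  · by_contra hc
    have hJ : (Ideal.span {p}).IsPrime := (Ideal.span_singleton_prime hp.ne_zero).2 hp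
    have hlt : Ideal.span {p} < w.center hx hy := by
      refine lt_of_le_of_ne ((Ideal.span_singleton_le_iff_mem _).2 hpI) fun he => ?_
      have : Q ∈ Ideal.span {p} := he ▸ hQ
      exact hc (Ideal.mem_span_singleton.1 this)
    have hbot : ⊥ < Ideal.span {p} := bot_lt_iff_ne_bot.2 (by simpa using hp.ne_zero)
    have hmax := isMaximal_of_lt_of_lt hbot hlt
    obtain ⟨z, hz⟩ := isMaximal_iff_eq_vanishingIdeal_singleton.1 hmax
    apply hs (z 0)
    have : X 0 - C (z 0) ∈ w.center hx hy := by
      rw [hz, mem_vanishingIdeal_singleton_iff]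
      simp
    simpa [mem_center] using this

end DivVal

/-! ### Untwisting -/

/-- Exponents of sections of a line bundle on a Hirzebruch surface. -/
def Ruled (n : ℤ) (a : ℕ) (β : ℤ) (i j : ℕ) : Prop := j ≤ a ∧ (i : ℤ) + n * j ≤ β

/-- Exponents of plane curves of degree `d`. -/
def Plane (d : ℕ) (i j : ℕ) : Prop := i + j ≤ d

theorem State.mono {S S' : ℕ → ℕ → Prop} {x y : K2} (hS : ∀ i j, S i j → S' i j)
    (h : State S x y) : State S' x y := by
  obtain ⟨h, h0, hh⟩ := h
  exact ⟨h, h0, fun k hk => sys_mono hS (hh k hk)⟩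

theorem State.swap {S : ℕ → ℕ → Prop} {x y : K2} (h : State S x y) :
    State (fun i j => S j i) y x := by
  obtain ⟨h, h0, hh⟩ := h
  exact ⟨h, h0, fun k hk => sys_swap (hh k hk)⟩

theorem exists_ruled_of_mem_sys {S : ℕ → ℕ → Prop} {x y k : K2} {a : ℕ} (hS : ∀ i j, S i j → j ≤ a)
    (hk : k ∈ sys S x y) : ∃ b : ℕ, ∀ c : ℕ, b ≤ c → k ∈ sys (Ruled 0 a c) x y := by
  obtain ⟨P, hP, rfl⟩ := mem_sys_iff.1 hk
  refine ⟨degreeOf 0 P, fun c hc => mem_sys_iff.2 ⟨P, fun m hm => ⟨hS _ _ (hP m hm), ?_⟩, rfl⟩⟩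
  have := monomial_le_degreeOf 0 hm
  rw [zero_mul, add_zero]
  exact_mod_cast this.trans hc

theorem State.exists_ruled {x y : K2} {a : ℕ} (h : State (fun _ j => j ≤ a) x y) :
    ∃ β : ℤ, State (Ruled 0 a β) x y := by
  obtain ⟨h, h0, hh⟩ := h
  obtain ⟨b, hb⟩ := exists_ruled_of_mem_sys (fun _ _ => id) (hh h (Or.inl rfl))
  obtain ⟨b', hb'⟩ := exists_ruled_of_mem_sys (fun _ _ => id) (hh _ (Or.inr (Or.inl rfl)))
  obtain ⟨b'', hb''⟩ := exists_ruled_of_mem_sys (fun _ _ => id) (hh _ (Or.inr (Or.inr rfl)))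
  refine ⟨(b + b' + b'' : ℕ), h, h0, ?_⟩
  rintro k (rfl | rfl | rfl)
  exacts [hb _ (by omega), hb' _ (by omega), hb'' _ (by omega)]

section chart

variable {x y h : K2} {w : DivVal} {A B : ℕ} {S S' : ℕ → ℕ → Prop}

theorem state_of_center_curve (hJ : Jac x y ≠ 0) (h0 : h ≠ 0)
    (hS : ∀ k ∈ triple h, k ∈ sys S x y) (hx : w.v x ≤ 1) (hy : w.v y ≤ 1)
    (hV : Violates w h x y A B) (hs : ∀ s : ℂ, ¬ w.v (x - algebraMap ℂ K2 s) < 1)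
    (H : ∀ p Q : R2, degreeOf 1 p ≠ 0 → Q ≠ 0 → (∀ m ∈ (p * Q).support, S (m 0) (m 1)) →
      ∀ m ∈ Q.support, S' (m 0) (m 1)) : State S' x y := by
  have hk : ∀ k ∈ triple h, ∃ P : R2, (∀ m ∈ P.support, S (m 0) (m 1)) ∧ aeval ![x, y] P = k :=
    fun k hk => mem_sys_iff.1 (hS k hk)
  obtain ⟨P, -, hP⟩ := hk h (self_mem_triple h)
  have hP0 : P ≠ 0 := by
    rintro rfl
    exact h0 (by rw [← hP, map_zero])
  obtain ⟨p, hp0, hp1, hp⟩ := w.exists_prime_of_center_curve hx hy hs hP0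
    (hP ▸ w.lt_one_of_violates hx hy hV (self_mem_triple h))
  have hpa : aeval ![x, y] p ≠ 0 := fun h => hp0 (aeval_injective_of_Jac_ne_zero hJ h)
  refine ⟨(aeval ![x, y] p)⁻¹ * h, mul_ne_zero (inv_ne_zero hpa) h0,
    forall_triple_mul fun k hkt => ?_⟩
  obtain ⟨F, hF, hFk⟩ := hk k hkt
  obtain ⟨Q, rfl⟩ := hp F (hFk ▸ w.lt_one_of_violates hx hy hV hkt)
  rw [← hFk, map_mul, inv_mul_cancel_left₀ hpa]
  by_cases hQ : Q = 0
  · rw [hQ, map_zero]; exact Submodule.zero_mem _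
  · exact mem_sys_iff.2 ⟨Q, H p Q hp1 hQ hF, rfl⟩

theorem state_of_center_line (hx0 : x ≠ 0) (h0 : h ≠ 0) (hS : ∀ k ∈ triple h, k ∈ sys S x y)
    (hx : w.v x < 1) (hy : w.v y ≤ 1) (ht : ∀ t : ℂ, ¬ w.v (y - algebraMap ℂ K2 t) < 1)
    (hV : Violates w h x y A B) (H : ∀ i j, S (i + 1) j → S' i j) : State S' x y := by
  refine State.transform (S := fun i j => S i j ∧ 1 ≤ i) x⁻¹ (inv_ne_zero hx0) ?_
    ⟨h, h0, fun k hk => w.mem_sys_of_center_line hx hy ht hV hk (hS k hk)⟩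
  rintro (_ | i) j ⟨hij, hi⟩
  · omega
  · rw [pow_succ', mul_assoc, inv_mul_cancel_left₀ hx0]
    exact monomial_mem_sys (H i j hij)

theorem state_of_center_point (hJ : Jac x y ≠ 0) (hx0 : x ≠ 0) (h0 : h ≠ 0)
    (hS : ∀ k ∈ triple h, k ∈ sys S x y) (hx : w.v x < 1) (hy : w.v y < 1)
    (hV : Violates w h x y A B) {m : ℕ} (hm : B * m ≤ A + B)
    (H : ∀ i i' j, S i j → i' + m = i + j → S' i' j) : State S' x (y / x) := by
  refine State.transform (S := fun i j => S i j ∧ A < B * (i + j)) (x ^ m)⁻¹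
    (inv_ne_zero (pow_ne_zero _ hx0)) ?_
    ⟨h, h0, fun k hk => w.mem_sys_of_center_point hx hy hJ hV hk (hS k hk)⟩
  rintro i j ⟨hij, hA⟩
  have hmij : m ≤ i + j := by
    by_contra hc
    have : B * (i + j + 1) ≤ B * m := Nat.mul_le_mul_left _ (by omega)
    rw [mul_add] at this
    omega
  obtain ⟨i', hi'⟩ := Nat.exists_eq_add_of_le' hmij
  have e : (x ^ m)⁻¹ * (x ^ i * y ^ j) = x ^ i' * (y / x) ^ j := by
    rw [div_pow]
    field_simp
    rw [mul_right_comm, ← pow_add, hi', pow_add]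
    ring
  rw [e]
  exact monomial_mem_sys (H i i' j hij hi'.symm)

end chart

theorem ruled_chart {x y h : K2} {w : DivVal} {n β : ℤ} {a : ℕ} (hxy : Coord ⊤ x y) (h0 : h ≠ 0)
    (hS : ∀ k ∈ triple h, k ∈ sys (Ruled n a β) x y) (hx : w.v x ≤ 1) (hy : w.v y ≤ 1)
    (hn : 0 ≤ n ∨ w.v y < 1) (hV : Violates w h x y a 2)
    (ih : ∀ x y, Coord ⊤ x y → State (fun _ j => j < a) x y → Coord (commutator Cremona2) x y)
    (ihβ : ∀ x y n' β', Coord ⊤ x y → 2 * β' - a * (n' + 2) < 2 * β - a * (n + 2) →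
      State (Ruled n' a β') x y → Coord (commutator Cremona2) x y) :
    Coord (commutator Cremona2) x y := by
  by_cases hs : ∀ s : ℂ, ¬ w.v (x - algebraMap ℂ K2 s) < 1
  · refine ih x y hxy (state_of_center_curve hxy.jac_ne_zero h0 hS hx hy hV hs ?_)
    intro p Q hp hQ hpQ m hm
    have hp0 : p ≠ 0 := by rintro rfl; simp at hp
    have h1 : degreeOf 1 (p * Q) ≤ a := degreeOf_le_iff.2 fun m hm => (hpQ m hm).1
    rw [degreeOf_mul_eq hp0 hQ] at h1
    have := monomial_le_degreeOf 1 hm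
    omega
  · push Not at hs
    obtain ⟨s, hs⟩ := hs
    have hxy' := (coord_sub_left_iff le_top s).2 hxy
    have hS' : ∀ k ∈ triple h, k ∈ sys (Ruled n a β) (x - algebraMap ℂ K2 s) y :=
      fun k hk => sys_sub_left (fun i i' j hi hij => ⟨hij.1, by have := hij.2; omega⟩) s (hS k hk)
    have hV' : Violates w h (x - algebraMap ℂ K2 s) y a 2 := by
      have := Jac_sub_const x y s 0
      rw [map_zero, sub_zero] at this
      rw [Violates, this]; exact hV
    rw [← coord_sub_left_iff le_rfl s]
    generalize x - algebraMap ℂ K2 s = x at *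
    clear hS hV hxy hx
    have key : ∀ y, Coord ⊤ x y → (∀ k ∈ triple h, k ∈ sys (Ruled n a β) x y) →
        w.v y < 1 → Violates w h x y a 2 → Coord (commutator Cremona2) x y := by
      intro y hxy hS hy hV
      have hxy1 := (coord_div_iff le_top hxy.left_ne_zero).2 hxy
      rw [← coord_div_iff le_rfl hxy.left_ne_zero]
      refine ihβ x (y / x) (n - 1) (β - (a / 2 + 1 : ℕ)) hxy1 ?_
        (state_of_center_point hxy.jac_ne_zero hxy.left_ne_zero h0 hS hs hy hV
          (m := a / 2 + 1) (by omega) ?_)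
      · have : a + 1 ≤ 2 * (a / 2 + 1 : ℕ) := by omega
        zify at this ⊢
        linarith
      · rintro i i' j ⟨h1, h2⟩ h3
        refine ⟨h1, ?_⟩
        zify at h3 ⊢
        linarith
    by_cases hy1 : w.v y < 1
    · exact key y hxy' hS' hy1 hV'
    have hn := hn.resolve_right hy1
    by_cases ht : ∀ t : ℂ, ¬ w.v (y - algebraMap ℂ K2 t) < 1
    · refine ihβ x y n (β - 1) hxy' (by linarith)
        (state_of_center_line hxy'.left_ne_zero h0 hS' hs hy ht hV' ?_)
      rintro i j ⟨h1, h2⟩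
      push_cast at h2
      exact ⟨h1, by linarith⟩
    · push Not at ht
      obtain ⟨t, ht⟩ := ht
      rw [← coord_sub_right_iff le_rfl t]
      refine key _ ((coord_sub_right_iff le_top t).2 hxy') (fun k hk => ?_) ht ?_
      · refine sys_sub_right (fun i j j' hj hij => ⟨hj.trans hij.1, ?_⟩) t (hS' k hk)
        have h1 : n * j' ≤ n * j := mul_le_mul_of_nonneg_left (by exact_mod_cast hj) hn
        have := hij.2
        linarith
      · have := Jac_sub_const x y 0 t
        rw [map_zero, sub_zero] at this
        rw [Violates, this]; exact hV'

theorem plane_chart {x y h : K2} {w : DivVal} {d : ℕ} (hd : 2 ≤ d) (hxy : Coord ⊤ x y) (h0 : h ≠ 0)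
    (hS : ∀ k ∈ triple h, k ∈ sys (Plane d) x y) (hx : w.v x ≤ 1) (hy : w.v y ≤ 1)
    (hV : Violates w h x y d 3)
    (ih : ∀ x y, Coord ⊤ x y → State (Plane (d - 1)) x y → Coord (commutator Cremona2) x y)
    (ihr : ∀ x y (a : ℕ), Coord ⊤ x y → 3 * a < 2 * d → State (fun _ j => j ≤ a) x y →
      Coord (commutator Cremona2) x y) :
    Coord (commutator Cremona2) x y := by
  by_cases hs : ∀ s : ℂ, ¬ w.v (x - algebraMap ℂ K2 s) < 1
  · refine ih x y hxy (state_of_center_curve hxy.jac_ne_zero h0 hS hx hy hV hs ?_)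
    intro p Q hp hQ hpQ m hm
    have hp0 : p ≠ 0 := by rintro rfl; simp at hp
    have hsum : ∀ m : Fin 2 →₀ ℕ, m.sum (fun _ e => e) = m 0 + m 1 := fun m => by
      rw [Finsupp.sum_fintype _ _ (by simp), Fin.sum_univ_two]
    have h1 : totalDegree (p * Q) ≤ d :=
      Finset.sup_le fun m hm => by rw [hsum]; exact hpQ m hm
    rw [totalDegree_mul_of_isDomain hp0 hQ] at h1
    have h2 := le_totalDegree hm
    rw [hsum] at h2
    have h3 := degreeOf_le_totalDegree p 1
    change m 0 + m 1 ≤ d - 1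
    omega
  · push Not at hs
    obtain ⟨s, hs⟩ := hs
    have hxy' := (coord_sub_left_iff le_top s).2 hxy
    have hS' : ∀ k ∈ triple h, k ∈ sys (Plane d) (x - algebraMap ℂ K2 s) y :=
      fun k hk => sys_sub_left (fun i i' j hi hij => by unfold Plane at *; omega) s (hS k hk)
    have hV' : Violates w h (x - algebraMap ℂ K2 s) y d 3 := by
      have := Jac_sub_const x y s 0
      rw [map_zero, sub_zero] at this
      rw [Violates, this]; exact hV
    rw [← coord_sub_left_iff le_rfl s]
    generalize x - algebraMap ℂ K2 s = x at *
    clear hS hV hxy hx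
    by_cases ht : ∀ t : ℂ, ¬ w.v (y - algebraMap ℂ K2 t) < 1
    · refine ih x y hxy' (state_of_center_line hxy'.left_ne_zero h0 hS' hs hy ht hV' ?_)
      intro i j h1
      unfold Plane at *
      omega
    · push Not at ht
      obtain ⟨t, ht⟩ := ht
      have hxy1 := (coord_sub_right_iff le_top t).2 hxy'
      have hS1 : ∀ k ∈ triple h, k ∈ sys (Plane d) x (y - algebraMap ℂ K2 t) := fun k hk =>
        sys_sub_right (fun i j j' hj hij => by unfold Plane at *; omega) t (hS' k hk)
      have hV1 : Violates w h x (y - algebraMap ℂ K2 t) d 3 := by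
        have := Jac_sub_const x y 0 t
        rw [map_zero, sub_zero] at this
        rw [Violates, this]; exact hV'
      rw [← coord_sub_right_iff le_rfl t]
      generalize y - algebraMap ℂ K2 t = y at *
      have hst := state_of_center_point (S' := fun i _ => i ≤ d - (d / 3 + 1)) hxy1.jac_ne_zero
        hxy1.left_ne_zero h0 hS1 hs ht hV1 (m := d / 3 + 1) (by omega)
        (by intro i i' j h1 h2; unfold Plane at *; omega)
      rw [← coord_div_iff le_rfl hxy1.left_ne_zero, ← coord_swap_iff le_rfl]
      refine ihr _ _ (d - (d / 3 + 1)) ?_ (by omega) hst.swap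
      rwa [coord_swap_iff le_top, coord_div_iff le_top hxy1.left_ne_zero]

/-! ### Affine maps -/

section affine

variable {x y h : K2} {a b c a₀ b₀ c₀ a₁ b₁ c₁ : ℂ}

theorem coord_affine_left_iff {H : Subgroup Cremona2} (hH : commutator Cremona2 ≤ H) (hy : y ≠ 0)
    (ha : a ≠ 0) : Coord H (algebraMap ℂ K2 a * x + algebraMap ℂ K2 b * y + algebraMap ℂ K2 c) y ↔
      Coord H x y := by
  rw [coord_add_left_iff hH, coord_swap_iff hH, coord_shear_iff hH hy, coord_swap_iff hH,
    coord_scale_left_iff hH ha]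

theorem coord_X0_X1 : Coord (commutator Cremona2) X0 X1 := ⟨1, Subgroup.one_mem _, rfl, rfl⟩

theorem coord_of_affine_left (hxy : Coord ⊤ x y) (ha : a₀ ≠ 0)
    (h0 : X0 = algebraMap ℂ K2 a₀ * x + algebraMap ℂ K2 b₀ * y + algebraMap ℂ K2 c₀)
    (h1 : X1 = algebraMap ℂ K2 a₁ * x + algebraMap ℂ K2 b₁ * y + algebraMap ℂ K2 c₁) :
    Coord (commutator Cremona2) x y := by
  rw [← coord_affine_left_iff le_rfl hxy.right_ne_zero ha, ← h0]
  have hA : algebraMap ℂ K2 a₀ ≠ 0 := by simpa using ha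
  have e : X1 = algebraMap ℂ K2 (b₁ - a₁ / a₀ * b₀) * y + algebraMap ℂ K2 (a₁ / a₀) * X0 +
      algebraMap ℂ K2 (c₁ - a₁ / a₀ * c₀) := by
    rw [h0, h1]
    simp only [map_sub, map_mul, map_div₀]
    field_simp
    ring
  have hb : b₁ - a₁ / a₀ * b₀ ≠ 0 := by
    intro hb
    rw [hb] at e
    have := Jac_X0_X1
    rw [e] at this
    generalize a₁ / a₀ = u at this
    simp [Jac] at this
  rw [← coord_scale_right_iff le_rfl hb, ← coord_shear_iff le_rfl X0_ne_zero (a₁ / a₀),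
    ← coord_add_right_iff le_rfl (c₁ - a₁ / a₀ * c₀), ← e]
  exact coord_X0_X1

theorem coord_of_affine (hxy : Coord ⊤ x y)
    (h0 : X0 = algebraMap ℂ K2 a₀ * x + algebraMap ℂ K2 b₀ * y + algebraMap ℂ K2 c₀)
    (h1 : X1 = algebraMap ℂ K2 a₁ * x + algebraMap ℂ K2 b₁ * y + algebraMap ℂ K2 c₁) :
    Coord (commutator Cremona2) x y := by
  by_cases ha : a₀ = 0
  · have hb : b₀ ≠ 0 := by
      rintro rfl
      have := Jac_X0_X1
      rw [h0, ha] at this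
      simp [Jac] at this
    rw [← coord_swap_iff le_rfl]
    rw [add_comm (_ * x)] at h0 h1
    exact coord_of_affine_left ((coord_swap_iff le_top).2 hxy) hb h0 h1
  · exact coord_of_affine_left hxy ha h0 h1

theorem coord_of_projective_left (hxy : Coord ⊤ x y) (hh : h ≠ 0) (ha : a ≠ 0)
    (e : h = algebraMap ℂ K2 a * x + algebraMap ℂ K2 b * y + algebraMap ℂ K2 c)
    (h0 : X0 * h = algebraMap ℂ K2 a₀ * x + algebraMap ℂ K2 b₀ * y + algebraMap ℂ K2 c₀)
    (h1 : X1 * h = algebraMap ℂ K2 a₁ * x + algebraMap ℂ K2 b₁ * y + algebraMap ℂ K2 c₁) :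
    Coord (commutator Cremona2) x y := by
  have key : ∀ {H : Subgroup Cremona2}, commutator Cremona2 ≤ H →
      (Coord H (y / h) h⁻¹ ↔ Coord H x y) := fun {H} hH => by
    rw [← coord_affine_left_iff hH hxy.right_ne_zero ha, ← e, coord_inv_right_iff hH,
      coord_swap_iff hH, coord_div_iff hH hh]
  have hA : algebraMap ℂ K2 a ≠ 0 := by simpa using ha
  have key' : ∀ {z : K2} {a₀ b₀ c₀ : ℂ},
      z * h = algebraMap ℂ K2 a₀ * x + algebraMap ℂ K2 b₀ * y + algebraMap ℂ K2 c₀ →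
      z = algebraMap ℂ K2 (b₀ - a₀ / a * b) * (y / h) + algebraMap ℂ K2 (c₀ - a₀ / a * c) * h⁻¹ +
        algebraMap ℂ K2 (a₀ / a) := fun {z a₀ b₀ c₀} hz => by
    simp only [map_sub, map_mul, map_div₀]
    field_simp
    linear_combination algebraMap ℂ K2 a * hz - algebraMap ℂ K2 a₀ * e
  exact (key le_rfl).1 (coord_of_affine ((key le_top).2 hxy) (key' h0) (key' h1))

theorem mem_sys_plane_one {k : K2} (hk : k ∈ sys (Plane 1) x y) : ∃ a b c : ℂ,
    k = algebraMap ℂ K2 a * x + algebraMap ℂ K2 b * y + algebraMap ℂ K2 c := by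
  induction hk using Submodule.span_induction with
  | mem h hh =>
    obtain ⟨i, j, hij, rfl⟩ := hh
    change i + j ≤ 1 at hij
    obtain ⟨rfl, rfl⟩ | ⟨rfl, rfl⟩ | ⟨rfl, rfl⟩ :
        (i = 1 ∧ j = 0) ∨ (i = 0 ∧ j = 1) ∨ (i = 0 ∧ j = 0) := by omega
    exacts [⟨1, 0, 0, by simp⟩, ⟨0, 1, 0, by simp⟩, ⟨0, 0, 1, by simp⟩]
  | zero => exact ⟨0, 0, 0, by simp⟩
  | add k l _ _ hk hl =>
    obtain ⟨a, b, c, rfl⟩ := hk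
    obtain ⟨a', b', c', rfl⟩ := hl
    exact ⟨a + a', b + b', c + c', by simp only [map_add]; ring⟩
  | smul s k _ hk =>
    obtain ⟨a, b, c, rfl⟩ := hk
    exact ⟨s * a, s * b, s * c, by rw [Algebra.smul_def]; simp only [map_mul]; ring⟩

theorem coord_of_plane_one (hxy : Coord ⊤ x y) (hS : State (Plane 1) x y) :
    Coord (commutator Cremona2) x y := by
  obtain ⟨h, hh, hS⟩ := hS
  obtain ⟨a, b, c, e⟩ := mem_sys_plane_one (hS h (Or.inl rfl))
  obtain ⟨a₀, b₀, c₀, h0⟩ := mem_sys_plane_one (hS _ (Or.inr (Or.inl rfl)))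
  obtain ⟨a₁, b₁, c₁, h1⟩ := mem_sys_plane_one (hS _ (Or.inr (Or.inr rfl)))
  by_cases ha : a = 0
  · by_cases hb : b = 0
    · subst ha hb
      have e : h = algebraMap ℂ K2 c := by simpa using e
      subst e
      have key : ∀ {z : K2} {a₀ b₀ c₀ : ℂ}, z * algebraMap ℂ K2 c =
            algebraMap ℂ K2 a₀ * x + algebraMap ℂ K2 b₀ * y + algebraMap ℂ K2 c₀ →
          z = algebraMap ℂ K2 (a₀ / c) * x + algebraMap ℂ K2 (b₀ / c) * y +
            algebraMap ℂ K2 (c₀ / c) := fun {z a₀ b₀ c₀} hz => by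
        simp only [map_div₀]
        field_simp
        exact hz
      exact coord_of_affine hxy (key h0) (key h1)
    · rw [← coord_swap_iff le_rfl]
      rw [add_comm (_ * x)] at e h0 h1
      exact coord_of_projective_left ((coord_swap_iff le_top).2 hxy) hh hb e h0 h1
  · exact coord_of_projective_left hxy hh ha e h0 h1

theorem not_state_zero (hxy : Coord ⊤ x y) : ¬ State (fun _ j => j ≤ 0) x y := by
  rintro ⟨h, hh, hS⟩
  have key : ∀ k ∈ triple h, Jac k x = 0 := by
    intro k hk
    have := hS k hk
    clear hk
    induction this using Submodule.span_induction with
    | mem k hk =>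
      obtain ⟨i, j, hij, rfl⟩ := hk
      obtain rfl := Nat.le_zero.1 hij
      simp [Jac, Derivation.leibniz_pow]
      ring
    | zero => simp [Jac]
    | add k l _ _ hk hl =>
      simp only [Jac, map_add] at *
      linear_combination hk + hl
    | smul s k _ hk =>
      simp only [Jac, Derivation.map_smul, smul_mul_assoc] at *
      rw [← smul_sub, hk, smul_zero]
  have key' : ∀ z, Jac (z * h) x = 0 → Jac z x = 0 := by
    intro z hz
    have h1 := key h (Or.inl rfl)
    have : h * Jac z x = 0 := by
      simp only [Jac, Derivation.leibniz, smul_eq_mul] at *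
      linear_combination hz - z * h1
    exact (mul_eq_zero.1 this).resolve_left hh
  exact hxy.jac_ne_zero (Jac_eq_zero_of_Jac_eq_zero (key' _ (key _ (Or.inr (Or.inl rfl))))
    (key' _ (key _ (Or.inr (Or.inr rfl)))))

end affine

/-! ### The untwisting process -/

section untwist

variable {x y k : K2} {n β : ℤ} {a : ℕ}

theorem inv_mul_mem_ruled (hy : y ≠ 0) (hk : k ∈ sys (Ruled n a β) x y) :
    (y ^ a)⁻¹ * k ∈ sys (Ruled (-n) a (β - n * a)) x y⁻¹ := by
  refine mul_mem_of_mem_sys ?_ hk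
  rintro i j ⟨h1, h2⟩
  obtain ⟨j', rfl⟩ := Nat.exists_eq_add_of_le' h1
  have e : (y ^ (j' + j))⁻¹ * (x ^ i * y ^ j) = x ^ i * y⁻¹ ^ j' := by
    rw [pow_add, inv_pow]
    field_simp
  rw [e]
  refine monomial_mem_sys ⟨by omega, ?_⟩
  push_cast
  linarith

theorem zpow_mul_mem_ruled (hx : x ≠ 0) (hk : k ∈ sys (Ruled n a β) x y) :
    x ^ (-β) * k ∈ sys (Ruled n a β) x⁻¹ (y * x ^ (-n)) := by
  refine mul_mem_of_mem_sys ?_ hk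
  rintro i j ⟨h1, h2⟩
  obtain ⟨i', hi'⟩ := Int.eq_ofNat_of_zero_le (sub_nonneg.2 h2)
  have e : x ^ (-β) * (x ^ i * y ^ j) = x⁻¹ ^ i' * (y * x ^ (-n)) ^ j := by
    rw [mul_pow, ← zpow_natCast (x ^ (-n)), ← zpow_mul, ← zpow_natCast x⁻¹, inv_zpow',
      ← zpow_natCast x, ← mul_assoc, ← zpow_add₀ hx, mul_left_comm, ← zpow_add₀ hx, mul_comm]
    congr 2
    linarith
  rw [e]
  refine monomial_mem_sys ⟨h1, ?_⟩
  omega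

theorem coord_of_state_ruled (ha : 1 ≤ a)
    (ih : ∀ x y, Coord ⊤ x y → State (fun _ j => j < a) x y → Coord (commutator Cremona2) x y)
    (ihp : ∀ x y (d : ℕ), Coord ⊤ x y → 2 * d < 3 * a → State (Plane d) x y →
      Coord (commutator Cremona2) x y) :
    ∀ (D : ℕ) (x y : K2) (n β : ℤ), Coord ⊤ x y → 2 * β - a * (n + 2) < D →
      State (Ruled n a β) x y → Coord (commutator Cremona2) x y := by
  intro D
  induction D with
  | zero =>
    have key : ∀ (x y : K2) (n β : ℤ), 0 ≤ n → Coord ⊤ x y → 2 * β - a * (n + 2) < 0 →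
        State (Ruled n a β) x y → Coord (commutator Cremona2) x y := by
      intro x y n β hn hxy hβ hS
      by_cases hc : n * a ≤ β
      · have hn2 : n < 2 := by
          by_contra hn2
          have : 2 * (a : ℤ) ≤ n * a := mul_le_mul_of_nonneg_right (by omega) (by omega)
          linarith
        obtain rfl | rfl : n = 0 ∨ n = 1 := by omega
        · rw [← coord_swap_iff le_rfl]
          refine ih y x ((coord_swap_iff le_top).2 hxy) ((hS.mono ?_).swap (S := fun i _ => i < a))
          rintro i j ⟨h1, h2⟩
          omega
        · refine ihp x y β.toNat hxy (by omega) (hS.mono ?_)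
          rintro i j ⟨h1, h2⟩
          unfold Plane
          omega
      · refine ih x y hxy (hS.mono ?_)
        rintro i j ⟨h1, h2⟩
        by_contra hj
        obtain rfl : j = a := by omega
        omega
    intro x y n β hxy hβ hS
    rcases le_total 0 n with hn | hn
    · exact key x y n β hn hxy hβ hS
    · rw [← coord_inv_right_iff le_rfl]
      refine key x y⁻¹ (-n) (β - n * a) (by omega) ((coord_inv_right_iff le_top).2 hxy) ?_ ?_
      · push_cast at hβ
        linarith
      · obtain ⟨h, h0, hS⟩ := hS
        have hy := hxy.right_ne_zero
        exact ⟨(y ^ a)⁻¹ * h, mul_ne_zero (inv_ne_zero (pow_ne_zero _ hy)) h0,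
          forall_triple_mul fun k hk => inv_mul_mem_ruled hy (hS k hk)⟩
  | succ D ihD =>
    have key : ∀ (x y h : K2) (n β : ℤ) (w : DivVal), 0 ≤ n → Coord ⊤ x y →
        2 * β - a * (n + 2) < D + 1 → h ≠ 0 → (∀ k ∈ triple h, k ∈ sys (Ruled n a β) x y) →
        Violates w h x y a 2 → w.v x ≤ 1 → Coord (commutator Cremona2) x y := by
      intro x y h n β w hn hxy hβ h0 hS hV hx
      by_cases hy : w.v y ≤ 1
      · exact ruled_chart hxy h0 hS hx hy (Or.inl hn) hV ih
          fun x y n' β' hxy h1 hS => ihD x y n' β' hxy (by omega) hS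
      · have hy0 := hxy.right_ne_zero
        have hc : (y ^ a)⁻¹ ≠ 0 := inv_ne_zero (pow_ne_zero _ hy0)
        have hy1 : w.v y⁻¹ < 1 := by
          rw [map_inv₀]
          exact inv_lt_one_of_one_lt₀ (not_le.1 hy)
        rw [← coord_inv_right_iff le_rfl]
        refine ruled_chart ((coord_inv_right_iff le_top).2 hxy) (mul_ne_zero hc h0)
          (forall_triple_mul fun k hk => inv_mul_mem_ruled hy0 (hS k hk)) hx hy1.le (Or.inr hy1)
          (hV.transform hc (Jac_inv_right x y hy0) ?_) ih
          fun x y n' β' hxy h1 hS => ihD x y n' β' hxy (by linarith) hS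
        rw [Valuation.map_neg, ← map_pow, ← map_pow]
        apply le_of_eq
        congr 1
        rw [inv_pow, inv_pow, ← pow_mul, ← pow_mul, mul_comm]
    have key' : ∀ (x y : K2) (n β : ℤ), 0 ≤ n → Coord ⊤ x y → 0 ≤ 2 * β - a * (n + 2) →
        2 * β - a * (n + 2) < D + 1 →
        State (Ruled n a β) x y → Coord (commutator Cremona2) x y := by
      intro x y n β hn hxy hβ0 hβ hS
      obtain ⟨h, h0, hS⟩ := hS
      obtain ⟨w, hV⟩ := exists_violates hxy.jac_ne_zero h0 (A := a) (B := 2) (by omega)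
      by_cases hx : w.v x ≤ 1
      · exact key x y h n β w hn hxy hβ h0 hS hV hx
      · have hx0 := hxy.left_ne_zero
        have hc : x ^ (-β) ≠ 0 := zpow_ne_zero _ hx0
        rw [← coord_mul_zpow_iff le_rfl hx0 (-n), ← coord_inv_left_iff le_rfl]
        refine key _ _ (x ^ (-β) * h) n β w hn ?_ hβ (mul_ne_zero hc h0)
          (forall_triple_mul fun k hk => zpow_mul_mem_ruled hx0 (hS k hk))
          (hV.transform hc (Jac_inv_mul_zpow x y hx0 n) ?_) ?_
        · rwa [coord_inv_left_iff le_top, coord_mul_zpow_iff le_top hx0]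
        · rw [Valuation.map_neg, map_zpow₀, map_zpow₀, ← zpow_natCast, ← zpow_natCast, ← zpow_mul,
            ← zpow_mul]
          refine zpow_le_zpow_right₀ (not_le.1 hx).le ?_
          push_cast
          linarith
        · rw [map_inv₀]
          exact inv_le_one_of_one_le₀ (not_le.1 hx).le
    intro x y n β hxy hβ hS
    push_cast at hβ
    by_cases hβ0 : 0 ≤ 2 * β - a * (n + 2)
    · rcases le_total 0 n with hn | hn
      · exact key' x y n β hn hxy hβ0 hβ hS
      · rw [← coord_inv_right_iff le_rfl]
        refine key' x y⁻¹ (-n) (β - n * a) (by omega) ((coord_inv_right_iff le_top).2 hxy)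
          (by linarith) (by linarith) ?_
        obtain ⟨h, h0, hS⟩ := hS
        have hy := hxy.right_ne_zero
        exact ⟨(y ^ a)⁻¹ * h, mul_ne_zero (inv_ne_zero (pow_ne_zero _ hy)) h0,
          forall_triple_mul fun k hk => inv_mul_mem_ruled hy (hS k hk)⟩
    · exact ihD x y n β hxy (by omega) hS

theorem coord_of_state_plane {d : ℕ} (hd : 2 ≤ d)
    (ih : ∀ x y, Coord ⊤ x y → State (Plane (d - 1)) x y → Coord (commutator Cremona2) x y)
    (ihr : ∀ x y (a : ℕ), Coord ⊤ x y → 3 * a < 2 * d → State (fun _ j => j ≤ a) x y →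
      Coord (commutator Cremona2) x y) (hxy : Coord ⊤ x y) (hS : State (Plane d) x y) :
    Coord (commutator Cremona2) x y := by
  obtain ⟨h, h0, hS⟩ := hS
  obtain ⟨w, hV⟩ := exists_violates hxy.jac_ne_zero h0 (A := d) (B := 3) (by omega)
  have hpr : ∀ i j, Plane d i j ↔ Ruled 1 d d i j := fun i j => by unfold Plane Ruled; omega
  have key : ∀ x y, Coord ⊤ x y → (∀ k ∈ triple h, k ∈ sys (Plane d) x y) → Violates w h x y d 3 →
      1 < w.v x → w.v y ≤ w.v x → Coord (commutator Cremona2) x y := by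
    intro x y hxy hS hV hx hyx
    have hx0 := hxy.left_ne_zero
    have hc : x ^ (-(d : ℤ)) ≠ 0 := zpow_ne_zero _ hx0
    rw [← coord_mul_zpow_iff le_rfl hx0 (-1), ← coord_inv_left_iff le_rfl]
    refine plane_chart hd (w := w) ?_ (mul_ne_zero hc h0)
      (forall_triple_mul fun k hk => sys_mono (fun i j => (hpr i j).2) (zpow_mul_mem_ruled hx0
        (sys_mono (fun i j => (hpr i j).1) (hS k hk)))) ?_ ?_
      (hV.transform hc (Jac_inv_mul_zpow x y hx0 1) ?_) ih ihr
    · rwa [coord_inv_left_iff le_top, coord_mul_zpow_iff le_top hx0]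
    · rw [map_inv₀]
      exact inv_le_one_of_one_le₀ hx.le
    · rw [zpow_neg_one, ← div_eq_mul_inv, map_div₀]
      exact (div_le_one₀ (zero_lt_one.trans hx)).2 hyx
    · rw [Valuation.map_neg, map_zpow₀, map_zpow₀, ← zpow_natCast, ← zpow_natCast, ← zpow_mul,
        ← zpow_mul]
      apply le_of_eq
      congr 1
      push_cast
      ring
  by_cases hv : w.v x ≤ 1 ∧ w.v y ≤ 1
  · exact plane_chart hd hxy h0 hS hv.1 hv.2 hV ih ihr
  rcases le_total (w.v y) (w.v x) with hyx | hyx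
  · exact key x y hxy hS hV (by by_contra hc; exact hv ⟨not_lt.1 hc, hyx.trans (not_lt.1 hc)⟩) hyx
  · rw [← coord_swap_iff le_rfl]
    refine key y x ((coord_swap_iff le_top).2 hxy) (fun k hk => ?_) ?_
      (by by_contra hc; exact hv ⟨hyx.trans (not_lt.1 hc), not_lt.1 hc⟩) hyx
    · exact sys_mono (fun i j hij => by unfold Plane at *; omega) (sys_swap (hS k hk))
    · rw [Violates, Jac_swap, mul_neg, Valuation.map_neg]
      exact hV

theorem coord_of_state (N : ℕ) :
    (∀ a x y, 3 * a ≤ N → Coord ⊤ x y → State (fun _ j => j ≤ a) x y →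
      Coord (commutator Cremona2) x y) ∧
    (∀ d x y, 2 * d ≤ N → Coord ⊤ x y → State (Plane d) x y →
      Coord (commutator Cremona2) x y) := by
  induction N using Nat.strong_induction_on with
  | _ N ih =>
    constructor
    · intro a x y ha hxy hS
      rcases Nat.eq_zero_or_pos a with rfl | ha0
      · exact absurd hS (not_state_zero hxy)
      · obtain ⟨β, hS⟩ := hS.exists_ruled
        refine coord_of_state_ruled ha0 (fun x y hxy hS => ?_) (fun x y d hxy hd hS => ?_)
          (2 * β - a * (0 + 2) + 1).toNat x y 0 β hxy (by omega) hS
        · exact (ih (3 * (a - 1)) (by omega)).1 (a - 1) x y le_rfl hxy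
            (hS.mono fun i j hj => by omega)
        · exact (ih (2 * d) (by omega)).2 d x y le_rfl hxy hS
    · intro d x y hd hxy hS
      rcases Nat.lt_or_ge d 2 with hd2 | hd2
      · exact coord_of_plane_one hxy (hS.mono fun i j hij => by unfold Plane at *; omega)
      · exact coord_of_state_plane hd2
          (fun x y hxy hS => (ih (2 * (d - 1)) (by omega)).2 _ x y le_rfl hxy hS)
          (fun x y a hxy ha hS => (ih (3 * a) (by omega)).1 a x y le_rfl hxy hS) hxy hS

theorem exists_state_plane (hxy : Coord ⊤ x y) : ∃ d, State (Plane d) x y := by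
  obtain ⟨φ, -, rfl, rfl⟩ := hxy
  obtain ⟨p, q, hq, e0⟩ := exists_frac (φ.symm X0)
  obtain ⟨r, s, hs, e1⟩ := exists_frac (φ.symm X1)
  have hφ : ∀ P : R2, φ (algebraMap R2 K2 P) = aeval ![φ X0, φ X1] P := by
    intro P
    have : (φ : K2 →ₐ[ℂ] K2).comp (Algebra.algHom ℂ R2 K2) = aeval ![φ X0, φ X1] := by
      ext i; fin_cases i <;> simp [X0, X1] <;> rfl
    exact DFunLike.congr_fun this P
  have hφ0 : ∀ P : R2, P ≠ 0 → aeval ![φ X0, φ X1] P ≠ 0 := by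
    intro P hP
    rw [← hφ]
    simpa using hP
  have e0 : X0 * aeval ![φ X0, φ X1] q = aeval ![φ X0, φ X1] p := by
    rw [← hφ, ← hφ, ← φ.apply_symm_apply X0, e0, ← map_mul]
    congr 1
    have : algebraMap R2 K2 q ≠ 0 := by simpa using hq
    field_simp
  have e1 : X1 * aeval ![φ X0, φ X1] s = aeval ![φ X0, φ X1] r := by
    rw [← hφ, ← hφ, ← φ.apply_symm_apply X1, e1, ← map_mul]
    congr 1
    have : algebraMap R2 K2 s ≠ 0 := by simpa using hs
    field_simp
  have hmem : ∀ P : R2, ∀ d, totalDegree P ≤ d →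
      aeval ![φ X0, φ X1] P ∈ sys (Plane d) (φ X0) (φ X1) := by
    refine fun P d hd => mem_sys_iff.2 ⟨P, fun m hm => ?_, rfl⟩
    have := le_totalDegree hm
    rw [Finsupp.sum_fintype _ _ (by simp), Fin.sum_univ_two] at this
    exact this.trans hd
  refine ⟨totalDegree (q * s) + totalDegree (p * s) + totalDegree (q * r),
    aeval ![φ X0, φ X1] (q * s), hφ0 _ (mul_ne_zero hq hs), ?_⟩
  rintro k (rfl | rfl | rfl)
  · exact hmem _ _ (by omega)
  · rw [map_mul, ← mul_assoc, e0, ← map_mul]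
    exact hmem _ _ (by omega)
  · rw [map_mul, mul_left_comm, e1, ← map_mul]
    exact hmem _ _ (by omega)

end untwist

end Cremona

/-- The plane Cremona group is perfect: the commutator subgroup of
`Bir(ℙ²_ℂ) = Aut_ℂ(ℂ(x,y))` is the whole group. -/
theorem cremona_perfect : commutator Cremona2 = ⊤ := by
  refine (Subgroup.eq_top_iff' _).2 fun φ => ?_
  have hφ : Cremona.Coord ⊤ (φ X0) (φ X1) := ⟨φ, Subgroup.mem_top φ, rfl, rfl⟩
  obtain ⟨d, hS⟩ := Cremona.exists_state_plane hφ
  obtain ⟨g, hg, h0, h1⟩ := (Cremona.coord_of_state (2 * d)).2 d _ _ le_rfl hφ hS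
  rwa [← Cremona.cremona_ext h0 h1]
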